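/- arXiv:2212.12692 — 5 statements merged into one kernel-verified Lean document; each statement's English description precedes it below -/
import Mathlib

section
/- Let α ∈ (0,1), a < t₀ reals, let A be a real symmetric d×d matrix with eigenvalues λ₁,…,λ_d and set λ_max = max_i |λ_i|, let M ≥ 0 and let g : [a,t₀] → ℝ be continuous with |g(s)| ≤ M for all s. Suppose Φ : [a,t₀) → ℝ^{d×d} satisfies Φ(τ) = (t₀−τ)^{α−1}/Γ(α) · 𝕀 + (1/Γ(α)) ∫_τ^{t₀} (s−τ)^{α−1} g(s) A Φ(s) ds for all τ ∈ [a,t₀), with τ ↦ (t₀−τ)^{1−α}Φ(τ) extending continuously to [a,t₀]. Then for every τ ∈ [a,t₀): E_{α,α}(−λ_max M (t₀−a)^α) ≤ ‖(t₀−τ)^{1−α} Φ(τ)‖ ≤ E_{α,α}(λ_max M (t₀−a)^α), where ‖·‖ is the operator norm induced by the Euclidean norm. -/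
open MeasureTheory Set Matrix

attribute [local instance] Matrix.normedAddCommGroup Matrix.normedSpace

/-- The two-parameter Mittag-Leffler function `E_{α,β}(x) = Σ_{k=0}^∞ x^k / Γ(αk+β)`. -/
noncomputable def mittagLeffler2 (α β x : ℝ) : ℝ :=
  ∑' k : ℕ, x ^ k / Real.Gamma (α * k + β)

open Filter Topology

/-- The kernel `x ^ (p - 1) / Γ(p)` of the Riemann–Liouville integral of order `p`, extended by
zero to `x ≤ 0`. -/
noncomputable def rlKernel (p : ℝ) : ℝ → ℝ :=
  indicator (Ioi 0) fun x => x ^ (p - 1) / Real.Gamma p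

/-- The convolution of two real functions on the line. -/
noncomputable def conv (f g : ℝ → ℝ) (x : ℝ) : ℝ := ∫ t, f t * g (x - t)

lemma conv_eq_convolution (f g : ℝ → ℝ) :
    conv f g = convolution f g (ContinuousLinearMap.mul ℝ ℝ) volume := rfl

lemma conv_comm (f g : ℝ → ℝ) : conv f g = conv g f := by
  ext x
  rw [conv_eq_convolution f g, convolution_mul_swap, conv]
  exact integral_congr_ae (.of_forall fun t => mul_comm _ _)

lemma rlKernel_of_pos {p x : ℝ} (hx : 0 < x) : rlKernel p x = x ^ (p - 1) / Real.Gamma p :=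
  indicator_of_mem (mem_Ioi.2 hx) _

lemma rlKernel_of_nonpos {p x : ℝ} (hx : x ≤ 0) : rlKernel p x = 0 :=
  indicator_of_notMem (not_lt.2 hx) _

lemma rlKernel_nonneg {p : ℝ} (hp : 0 < p) (x : ℝ) : 0 ≤ rlKernel p x :=
  indicator_nonneg (fun _ hx => div_nonneg (Real.rpow_nonneg (le_of_lt hx) _)
    (Real.Gamma_pos_of_pos hp).le) x

lemma rlKernel_pos {p x : ℝ} (hp : 0 < p) (hx : 0 < x) : 0 < rlKernel p x := by
  rw [rlKernel_of_pos hx]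
  exact div_pos (Real.rpow_pos_of_pos hx _) (Real.Gamma_pos_of_pos hp)

lemma measurable_rlKernel (p : ℝ) : Measurable (rlKernel p) :=
  Measurable.indicator (by fun_prop) measurableSet_Ioi

lemma mul_sub_eq_indicator {f g : ℝ → ℝ} (hf : ∀ t ≤ 0, f t = 0) (hg : ∀ t ≤ 0, g t = 0) (x : ℝ) :
    (fun t => f t * g (x - t)) = indicator (Ioo 0 x) fun t => f t * g (x - t) := by
  ext t
  by_cases ht : t ∈ Ioo 0 x
  · rw [indicator_of_mem ht]
  · rw [indicator_of_notMem ht]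
    rcases le_or_gt t 0 with h | h
    · rw [hf t h, zero_mul]
    · rw [hg (x - t) (sub_nonpos.2 (not_lt.1 fun h' => ht ⟨h, h'⟩)), mul_zero]

lemma conv_of_nonpos {f g : ℝ → ℝ} (hf : ∀ t ≤ 0, f t = 0) (hg : ∀ t ≤ 0, g t = 0)
    {x : ℝ} (hx : x ≤ 0) : conv f g x = 0 := by
  rw [conv, mul_sub_eq_indicator hf hg, Ioo_eq_empty (not_lt.2 hx)]
  simp

lemma conv_eq_setIntegral {f g : ℝ → ℝ} (hf : ∀ t ≤ 0, f t = 0) (hg : ∀ t ≤ 0, g t = 0) (x : ℝ) :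
    conv f g x = ∫ t in Ioo 0 x, f t * g (x - t) := by
  rw [← integral_indicator measurableSet_Ioo, ← mul_sub_eq_indicator hf hg, conv]

lemma integral_rpow_mul_sub_rpow {p q x : ℝ} (hp : 0 < p) (hq : 0 < q) (hx : 0 < x) :
    ∫ t in (0 : ℝ)..x, t ^ (p - 1) * (x - t) ^ (q - 1) =
      x ^ (p + q - 1) * (Real.Gamma p * Real.Gamma q / Real.Gamma (p + q)) := by
  have h := Complex.betaIntegral_scaled p q hx
  rw [Complex.betaIntegral_eq_Gamma_mul_div _ _ (by simpa) (by simpa)] at h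
  have h2 : ∫ t in (0 : ℝ)..x, (t : ℂ) ^ ((p : ℂ) - 1) * ((x : ℂ) - t) ^ ((q : ℂ) - 1) =
      ∫ t in (0 : ℝ)..x, ((t ^ (p - 1) * (x - t) ^ (q - 1) : ℝ) : ℂ) := by
    refine intervalIntegral.integral_congr fun t ht => ?_
    rw [uIcc_of_le hx.le] at ht
    push_cast [Complex.ofReal_cpow ht.1, Complex.ofReal_cpow (sub_nonneg.2 ht.2)]
    rfl
  rw [h2, intervalIntegral.integral_ofReal] at h
  apply Complex.ofReal_injective
  rw [h]
  push_cast [Complex.ofReal_cpow hx.le, ← Complex.Gamma_ofReal]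
  rfl

/-- The semigroup property of the Riemann–Liouville kernels. -/
lemma conv_rlKernel {p q : ℝ} (hp : 0 < p) (hq : 0 < q) :
    conv (rlKernel p) (rlKernel q) = rlKernel (p + q) := by
  ext x
  rcases le_or_gt x 0 with hx | hx
  · rw [conv_of_nonpos (fun t => rlKernel_of_nonpos) (fun t => rlKernel_of_nonpos) hx,
      rlKernel_of_nonpos hx]
  · rw [conv_eq_setIntegral (fun t => rlKernel_of_nonpos) (fun t => rlKernel_of_nonpos),
      rlKernel_of_pos hx]
    have h : ∀ t ∈ Ioo 0 x, rlKernel p t * rlKernel q (x - t) =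
        (Real.Gamma p * Real.Gamma q)⁻¹ * (t ^ (p - 1) * (x - t) ^ (q - 1)) := fun t ht => by
      rw [rlKernel_of_pos ht.1, rlKernel_of_pos (sub_pos.2 ht.2)]
      field_simp
    rw [setIntegral_congr_fun measurableSet_Ioo h, integral_const_mul,
      ← integral_Ioc_eq_integral_Ioo, ← intervalIntegral.integral_of_le hx.le,
      integral_rpow_mul_sub_rpow hp hq hx]
    have := (Real.Gamma_pos_of_pos hp).ne'
    have := (Real.Gamma_pos_of_pos hq).ne'
    field_simp

lemma integrable_rlKernel_mul_rlKernel {p q : ℝ} (hp : 0 < p) (hq : 0 < q) (x : ℝ) :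
    Integrable fun t => rlKernel p t * rlKernel q (x - t) := by
  rcases le_or_gt x 0 with hx | hx
  · rw [mul_sub_eq_indicator (fun t => rlKernel_of_nonpos) (fun t => rlKernel_of_nonpos),
      Ioo_eq_empty (not_lt.2 hx)]
    simp
  · refine not_imp_comm.1 integral_undef ?_
    change conv (rlKernel p) (rlKernel q) x ≠ 0
    rw [conv_rlKernel hp hq]
    exact (rlKernel_pos (add_pos hp hq) hx).ne'

/-- A measurable function dominated by a multiple of the kernel of order `p`. -/
structure KernelBounded (p C : ℝ) (f : ℝ → ℝ) : Prop where
  aestronglyMeasurable : AEStronglyMeasurable f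
  abs_le : ∀ x, |f x| ≤ C * rlKernel p x

lemma kernelBounded_rlKernel {p : ℝ} (hp : 0 < p) : KernelBounded p 1 (rlKernel p) where
  aestronglyMeasurable := (measurable_rlKernel p).aestronglyMeasurable
  abs_le x := by rw [abs_of_nonneg (rlKernel_nonneg hp x), one_mul]

namespace KernelBounded

variable {p q C D : ℝ} {f g : ℝ → ℝ}

lemma eq_zero (hf : KernelBounded p C f) {x : ℝ} (hx : x ≤ 0) : f x = 0 := by
  simpa [rlKernel_of_nonpos hx] using hf.abs_le x

lemma add (hf : KernelBounded p C f) (hg : KernelBounded p D g) :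
    KernelBounded p (C + D) fun x => f x + g x where
  aestronglyMeasurable := hf.1.add hg.1
  abs_le x := by linarith [abs_add_le (f x) (g x), hf.2 x, hg.2 x]

lemma mul_of_abs_le (hf : KernelBounded p C f) (hg : AEStronglyMeasurable g)
    (h : ∀ x, |g x| ≤ D) : KernelBounded p (D * C) fun x => g x * f x where
  aestronglyMeasurable := hg.mul hf.1
  abs_le x := by
    rw [abs_mul, mul_assoc]
    exact mul_le_mul (h x) (hf.2 x) (abs_nonneg _) ((abs_nonneg _).trans (h x))

lemma abs_mul_le (hf : KernelBounded p C f) (hg : KernelBounded q D g) (x t : ℝ) :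
    |f t * g (x - t)| ≤ C * D * (rlKernel p t * rlKernel q (x - t)) := by
  rw [abs_mul, mul_mul_mul_comm]
  exact mul_le_mul (hf.2 _) (hg.2 _) (abs_nonneg _) ((abs_nonneg _).trans (hf.2 _))

lemma integrable (hp : 0 < p) (hq : 0 < q) (hf : KernelBounded p C f) (hg : KernelBounded q D g)
    (x : ℝ) : Integrable fun t => f t * g (x - t) := by
  refine ((integrable_rlKernel_mul_rlKernel hp hq x).const_mul (C * D)).mono' ?_
    (.of_forall fun t => hf.abs_mul_le hg x t)
  exact hf.1.mul (hg.1.comp_quasiMeasurePreserving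
    (quasiMeasurePreserving_sub_left volume x))

lemma norm_conv_le (hp : 0 < p) (hq : 0 < q) (hf : KernelBounded p C f)
    (hg : KernelBounded q D g) (x : ℝ) : |conv f g x| ≤ C * D * rlKernel (p + q) x := by
  rw [← conv_rlKernel hp hq]
  change |conv f g x| ≤ C * D * ∫ t, rlKernel p t * rlKernel q (x - t)
  rw [← integral_const_mul]
  refine norm_integral_le_of_norm_le (f := fun t => f t * g (x - t))
    ((integrable_rlKernel_mul_rlKernel hp hq x).const_mul (C * D))
    (.of_forall fun t => ?_)
  exact hf.abs_mul_le hg x t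

lemma conv (hp : 0 < p) (hq : 0 < q) (hf : KernelBounded p C f)
    (hg : KernelBounded q D g) : KernelBounded (p + q) (C * D) (conv f g) where
  aestronglyMeasurable := by
    refine AEStronglyMeasurable.integral_prod_right' (f := fun z : ℝ × ℝ => f z.2 * g (z.1 - z.2)) ?_
    exact hf.1.comp_snd.mul (hg.1.comp_quasiMeasurePreserving
      (quasiMeasurePreserving_sub_of_right_invariant volume volume))
  abs_le := hf.norm_conv_le hp hq hg

lemma abs (hf : KernelBounded p C f) : KernelBounded p C fun x => ‖f x‖ where
  aestronglyMeasurable := hf.1.norm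
  abs_le x := by simpa using hf.2 x

lemma conv_assoc {r B : ℝ} {k : ℝ → ℝ} (hp : 0 < p) (hq : 0 < q) (hr : 0 < r)
    (hf : KernelBounded p C f) (hg : KernelBounded q D g) (hk : KernelBounded r B k) (x : ℝ) :
    _root_.conv (_root_.conv f g) k x = _root_.conv f (_root_.conv g k) x :=
  let L := ContinuousLinearMap.mul ℝ ℝ
  convolution_assoc L L L L (fun a b c => mul_assoc a b c) hf.1 hg.1 hk.1
    (.of_forall fun y => (hf.integrable hp hq hg y :))
    (.of_forall fun y => (hg.abs.integrable hq hr hk.abs y :))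
    (hf.abs.integrable hp (add_pos hq hr) (hg.abs.conv hq hr hk.abs) x :)

end KernelBounded

lemma summable_mittagLeffler {α β : ℝ} (hα : α ∈ Ioo (0 : ℝ) 1) (hβ : 0 < β) (z : ℝ) :
    Summable fun n : ℕ => z ^ n / Real.Gamma (α * n + β) := by
  obtain ⟨hα0, hα1⟩ := hα
  have hs : Tendsto (fun n : ℕ => α * n + β) atTop atTop :=
    tendsto_atTop_add_const_right _ _
      (tendsto_natCast_atTop_atTop.const_mul_atTop hα0)
  have hlim : Tendsto (fun n : ℕ => |z| * (2 ^ (1 - α) * (α * n + β) ^ (-α))) atTop (𝓝 0) := by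
    simpa using (((tendsto_rpow_neg_atTop hα0).comp hs).const_mul (2 ^ (1 - α))).const_mul |z|
  refine summable_of_ratio_norm_eventually_le (r := 1 / 2) (by norm_num) ?_
  filter_upwards [hlim.eventually_le_const (show (0 : ℝ) < 1 / 2 by norm_num),
    hs.eventually_ge_atTop α] with n hn hnα
  have e : α * ((n + 1 : ℕ) : ℝ) + β = α * n + β + α := by push_cast; ring
  rw [e]
  set s := α * n + β
  have hs0 : 0 < s := hα0.trans_le hnα
  have h1 := Real.Gamma_mul_add_mul_le_rpow_Gamma_mul_rpow_Gamma (s := s + α) (t := s + α + 1)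
    (by linarith) (by linarith) hα0 (sub_pos.2 hα1) (by ring)
  have hG : 0 < Real.Gamma (s + α) := Real.Gamma_pos_of_pos (by linarith)
  have hGs : 0 < Real.Gamma s := Real.Gamma_pos_of_pos hs0
  rw [show α * (s + α) + (1 - α) * (s + α + 1) = s + 1 by ring, Real.Gamma_add_one hs0.ne',
    Real.Gamma_add_one (by linarith), Real.mul_rpow (by linarith) hG.le, mul_left_comm,
    ← Real.rpow_add hG, add_sub_cancel, Real.rpow_one] at h1
  have h2 : (s + α) ^ (1 - α) ≤ 2 ^ (1 - α) * s ^ (-α) * s := by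
    rw [mul_assoc]
    nth_rewrite 3 [← Real.rpow_one s]
    rw [← Real.rpow_add hs0, show -α + 1 = 1 - α by ring, ← Real.mul_rpow (by norm_num) hs0.le]
    exact Real.rpow_le_rpow (by linarith) (by linarith) (by linarith)
  have h3 : Real.Gamma s ≤ 2 ^ (1 - α) * s ^ (-α) * Real.Gamma (s + α) := by
    refine le_of_mul_le_mul_left (h1.trans ?_) hs0
    calc _ ≤ 2 ^ (1 - α) * s ^ (-α) * s * Real.Gamma (s + α) := by gcongr
      _ = _ := by ring
  have h4 : |z| * Real.Gamma s ≤ 1 / 2 * Real.Gamma (s + α) :=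
    calc |z| * Real.Gamma s ≤ |z| * (2 ^ (1 - α) * s ^ (-α) * Real.Gamma (s + α)) := by gcongr
      _ = |z| * (2 ^ (1 - α) * s ^ (-α)) * Real.Gamma (s + α) := by ring
      _ ≤ _ := by gcongr
  rw [norm_div, norm_div, norm_pow, norm_pow, Real.norm_eq_abs, Real.norm_of_nonneg hG.le,
    Real.norm_of_nonneg hGs.le, div_le_iff₀ hG, pow_succ, mul_div_assoc', div_mul_eq_mul_div,
    le_div_iff₀ hGs]
  calc |z| ^ n * |z| * Real.Gamma s = |z| ^ n * (|z| * Real.Gamma s) := by ring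
    _ ≤ |z| ^ n * (1 / 2 * Real.Gamma (s + α)) := by gcongr
    _ = _ := by ring

lemma continuous_mittagLeffler2 {α β : ℝ} (hα : α ∈ Ioo (0 : ℝ) 1) (hβ : 0 < β) :
    Continuous (mittagLeffler2 α β) := by
  refine continuous_iff_continuousAt.2 fun x => ?_
  have h : ContinuousOn (mittagLeffler2 α β) (Metric.closedBall 0 (|x| + 1)) := by
    refine continuousOn_tsum (fun n => by fun_prop) (summable_mittagLeffler hα hβ (|x| + 1))
      fun n y hy => ?_
    have hG : 0 < Real.Gamma (α * n + β) :=
      Real.Gamma_pos_of_pos (add_pos_of_nonneg_of_pos (mul_nonneg hα.1.le n.cast_nonneg) hβ)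
    rw [norm_div, norm_pow, Real.norm_of_nonneg hG.le]
    rw [mem_closedBall_zero_iff] at hy
    gcongr
  refine h.continuousAt (Metric.closedBall_mem_nhds_of_mem ?_)
  simp

lemma mittagLeffler2_zero (α β : ℝ) : mittagLeffler2 α β 0 = 1 / Real.Gamma β := by
  rw [mittagLeffler2, tsum_eq_single 0 fun n hn => by simp [hn]]
  simp

/-- The function `x ^ (α - 1) * E_{α,α}(z x ^ α)`, extended by zero to `x ≤ 0`; it is the solution
`R` of `R = k + z k * R`, where `k` is the kernel of order `α`. -/
noncomputable def rlResolvent (α z x : ℝ) : ℝ := ∑' n : ℕ, z ^ n * rlKernel (α * n + α) x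

section Resolvent

variable {α z x : ℝ}

lemma order_pos (hα : 0 < α) (n : ℕ) : 0 < α * n + α := by positivity

lemma rlKernel_order (hx : 0 < x) (n : ℕ) : z ^ n * rlKernel (α * n + α) x =
    x ^ (α - 1) * ((z * x ^ α) ^ n / Real.Gamma (α * n + α)) := by
  rw [rlKernel_of_pos hx, mul_pow, ← Real.rpow_mul_natCast hx.le,
    show α * n + α - 1 = (α - 1) + α * n by ring, Real.rpow_add hx]
  ring

lemma rlResolvent_of_pos (hx : 0 < x) :
    rlResolvent α z x = x ^ (α - 1) * mittagLeffler2 α α (z * x ^ α) := by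
  rw [rlResolvent, mittagLeffler2, ← tsum_mul_left]
  exact tsum_congr fun n => rlKernel_order hx n

lemma rlResolvent_of_nonpos (hx : x ≤ 0) : rlResolvent α z x = 0 := by
  simp [rlResolvent, rlKernel_of_nonpos hx]

lemma summable_rlResolvent (hα : α ∈ Ioo (0 : ℝ) 1) (z x : ℝ) :
    Summable fun n : ℕ => z ^ n * rlKernel (α * n + α) x := by
  rcases le_or_gt x 0 with hx | hx
  · simp [rlKernel_of_nonpos hx]
  · simp_rw [rlKernel_order hx]
    exact (summable_mittagLeffler hα hα.1 _).mul_left _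

lemma measurable_rlResolvent (hα : α ∈ Ioo (0 : ℝ) 1) (z : ℝ) : Measurable (rlResolvent α z) := by
  have h : rlResolvent α z =
      indicator (Ioi 0) fun x => x ^ (α - 1) * mittagLeffler2 α α (z * x ^ α) := by
    ext x
    rcases le_or_gt x 0 with hx | hx
    · rw [indicator_of_notMem (by simpa using hx), rlResolvent_of_nonpos hx]
    · rw [indicator_of_mem (by simpa using hx), rlResolvent_of_pos hx]
  rw [h]
  have := (continuous_mittagLeffler2 hα hα.1).measurable
  exact Measurable.indicator (by fun_prop) measurableSet_Ioi

lemma conv_order (hα : 0 < α) (n : ℕ) (x : ℝ) :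
    ∫ t, rlKernel (α * n + α) t * rlKernel α (x - t) = rlKernel (α * (n + 1 : ℕ) + α) x := by
  have h := congrFun (conv_rlKernel (order_pos hα n) hα) x
  rw [conv] at h
  rw [h]
  push_cast
  ring_nf

lemma rlResolvent_eq (hα : α ∈ Ioo (0 : ℝ) 1) (z x : ℝ) :
    rlResolvent α z x = rlKernel α x + z * conv (rlResolvent α z) (rlKernel α) x := by
  let F : ℕ → ℝ → ℝ := fun n t => z ^ n * rlKernel (α * n + α) t * rlKernel α (x - t)
  have hF : ∀ n, Integrable (F n) := fun n => by
    simpa only [F, mul_assoc] using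
      (integrable_rlKernel_mul_rlKernel (order_pos hα.1 n) hα.1 x).const_mul (z ^ n)
  have hint : ∀ w : ℝ, ∀ n : ℕ, ∫ t, w ^ n * rlKernel (α * n + α) t * rlKernel α (x - t) =
      w ^ n * rlKernel (α * (n + 1 : ℕ) + α) x := fun w n => by
    simp_rw [mul_assoc, integral_const_mul]
    rw [conv_order hα.1]
  have hsucc : ∀ w : ℝ, Summable fun n : ℕ => w ^ n * rlKernel (α * (n + 1 : ℕ) + α) x :=
    fun w => by
      rcases eq_or_ne w 0 with rfl | hw
      · exact summable_of_ne_finset_zero (s := {0}) fun n hn => by simp_all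
      · have h := (summable_nat_add_iff 1).2 (summable_rlResolvent hα w x)
        convert! h.mul_left w⁻¹ using 2 with n
        rw [pow_succ]
        field_simp
  have hnorm : ∀ n, ∫ t, ‖F n t‖ = |z| ^ n * rlKernel (α * (n + 1 : ℕ) + α) x := fun n => by
    rw [← hint]
    refine integral_congr_ae (.of_forall fun t => ?_)
    simp [F, abs_of_nonneg (rlKernel_nonneg (order_pos hα.1 n) t),
      abs_of_nonneg (rlKernel_nonneg hα.1 (x - t))]
  have h := hasSum_integral_of_summable_integral_norm hF (by simpa only [hnorm] using hsucc |z|)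
  have hconv : conv (rlResolvent α z) (rlKernel α) x =
      ∑' n : ℕ, z ^ n * rlKernel (α * (n + 1 : ℕ) + α) x := by
    rw [← tsum_congr (hint z), h.tsum_eq]
    refine integral_congr_ae (.of_forall fun t => ?_)
    simp only [F, rlResolvent, tsum_mul_right]
  rw [hconv, rlResolvent, (summable_rlResolvent hα z x).tsum_eq_zero_add, ← tsum_mul_left]
  congr 1
  · simp
  · exact tsum_congr fun n => by rw [pow_succ]; ring

end Resolvent

/-- A Grönwall inequality for the Riemann–Liouville kernel. -/
lemma le_rlResolvent_of_le_conv {α c C K : ℝ} (hα : α ∈ Ioo (0 : ℝ) 1) (hK : 0 ≤ K)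
    {y : ℝ → ℝ} (hy0 : ∀ x, 0 ≤ y x)
    (hyC : ∀ x, y x ≤ C * rlKernel α x)
    (hy : ∀ x, y x ≤ c * rlKernel α x + K * conv y (rlKernel α) x) (x : ℝ) :
    y x ≤ c * rlResolvent α K x := by
  have key : ∀ n : ℕ, ∀ x, y x ≤ c * ∑ j ∈ Finset.range n, K ^ j * rlKernel (α * j + α) x +
      C * (K ^ n * rlKernel (α * n + α) x) := by
    intro n
    induction n with
    | zero => intro x; simpa using hyC x
    | succ n ih =>
      intro x
      have hi := fun j : ℕ => integrable_rlKernel_mul_rlKernel (order_pos hα.1 j) hα.1 x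
      have hS : Integrable fun t => c * ∑ j ∈ Finset.range n,
          K ^ j * (rlKernel (α * j + α) t * rlKernel α (x - t)) :=
        (integrable_finsetSum _ fun j _ => (hi j).const_mul _).const_mul _
      have hT : Integrable fun t => C * (K ^ n * (rlKernel (α * n + α) t * rlKernel α (x - t))) :=
        ((hi n).const_mul _).const_mul _
      have hle : conv y (rlKernel α) x ≤
          c * ∑ j ∈ Finset.range n, K ^ j * rlKernel (α * (j + 1 : ℕ) + α) x +
          C * (K ^ n * rlKernel (α * (n + 1 : ℕ) + α) x) := by
        calc conv y (rlKernel α) x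
            ≤ ∫ t, (c * ∑ j ∈ Finset.range n,
                K ^ j * (rlKernel (α * j + α) t * rlKernel α (x - t)) +
                C * (K ^ n * (rlKernel (α * n + α) t * rlKernel α (x - t)))) := by
              refine integral_mono_of_nonneg (.of_forall fun t => mul_nonneg (hy0 t)
                (rlKernel_nonneg hα.1 _)) (hS.add hT) (.of_forall fun t => ?_)
              refine (mul_le_mul_of_nonneg_right (ih t) (rlKernel_nonneg hα.1 _)).trans_eq ?_
              simp only [add_mul, mul_assoc, Finset.sum_mul]
          _ = _ := by
              rw [integral_add hS hT, integral_const_mul, integral_const_mul, integral_const_mul,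
                integral_finsetSum _ fun j _ => (hi j).const_mul _]
              simp_rw [integral_const_mul, conv_order hα.1]
      refine (hy x).trans ((add_le_add_right (mul_le_mul_of_nonneg_left hle hK) _).trans_eq ?_)
      rw [Finset.sum_range_succ', mul_add, mul_add, Finset.mul_sum, Finset.mul_sum,
        Finset.mul_sum, pow_succ]
      simp only [pow_succ]
      have : ∀ j : ℕ, K * (c * (K ^ j * rlKernel (α * (j + 1 : ℕ) + α) x)) =
        c * (K ^ j * K * rlKernel (α * (j + 1 : ℕ) + α) x) := fun j => by ring
      simp_rw [this]
      simp
      ring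
  have hs := summable_rlResolvent hα K x
  have hlim := (hs.hasSum.tendsto_sum_nat.const_mul c).add (hs.tendsto_atTop_zero.const_mul C)
  rw [mul_zero, add_zero] at hlim
  exact ge_of_tendsto' hlim fun n => key n x

section Positivity

variable {α K : ℝ}

lemma integrable_rlResolvent_mul_rlKernel (hα : α ∈ Ioo (0 : ℝ) 1) (z x : ℝ) :
    Integrable fun t => rlResolvent α z t * rlKernel α (x - t) := by
  have hc : Continuous fun t : ℝ => mittagLeffler2 α α (z * t ^ α) :=
    (continuous_mittagLeffler2 hα hα.1).comp ((Real.continuous_rpow_const hα.1.le).const_mul z)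
  obtain ⟨C, hC⟩ := (isCompact_Icc (a := 0) (b := x)).exists_bound_of_continuousOn hc.continuousOn
  refine ((integrable_rlKernel_mul_rlKernel hα.1 hα.1 x).const_mul (C * Real.Gamma α)).mono' ?_
    (.of_forall fun t => ?_)
  · exact ((measurable_rlResolvent hα z).mul
      ((measurable_rlKernel α).comp (measurable_const.sub measurable_id))).aestronglyMeasurable
  · rcases le_or_gt t 0 with ht | ht
    · simp [rlResolvent_of_nonpos ht, rlKernel_of_nonpos ht]
    rcases le_or_gt x t with hxt | hxt
    · simp [rlKernel_of_nonpos (sub_nonpos.2 hxt)]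
    rw [norm_mul, Real.norm_of_nonneg (rlKernel_nonneg hα.1 _), ← mul_assoc]
    refine mul_le_mul_of_nonneg_right ?_ (rlKernel_nonneg hα.1 _)
    have hG := Real.Gamma_pos_of_pos hα.1
    have hp : 0 < t ^ (α - 1) := Real.rpow_pos_of_pos ht _
    rw [rlResolvent_of_pos ht, rlKernel_of_pos ht, norm_mul, Real.norm_of_nonneg hp.le]
    calc t ^ (α - 1) * ‖mittagLeffler2 α α (z * t ^ α)‖ ≤ t ^ (α - 1) * C := by
          gcongr
          exact hC t ⟨ht.le, hxt.le⟩
      _ = _ := by field_simp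

/-- If the Mittag-Leffler factor of the resolvent is positive up to its first nonpositive point
`x₀` and attains its maximum over `[x, x₀]` at `x`, then `x` is bounded away from `x₀`. -/
lemma rpow_le_of_isMaxOn (hα : α ∈ Ioo (0 : ℝ) 1) (hK : 0 ≤ K) {x x₀ : ℝ} (hx : 0 < x)
    (hxx : x < x₀) (hpos : ∀ t ∈ Ico 0 x₀, 0 < mittagLeffler2 α α (-K * t ^ α))
    (h₀ : mittagLeffler2 α α (-K * x₀ ^ α) ≤ 0)
    (hmax : ∀ t ∈ Icc x x₀,
      mittagLeffler2 α α (-K * t ^ α) ≤ mittagLeffler2 α α (-K * x ^ α)) :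
    x₀ ^ (α - 1) ≤ K * x ^ (α - 1) * rlKernel (1 + α) (x₀ - x) := by
  have hx₀ : 0 < x₀ := hx.trans hxx
  set R := rlResolvent α (-K) with hR
  set k := rlKernel α with hk
  set F : ℝ → ℝ := fun t => mittagLeffler2 α α (-K * t ^ α) with hF
  have hFx : 0 < F x := hpos x ⟨hx.le, hxx⟩
  have hRF : ∀ t, 0 < t → R t = t ^ (α - 1) * F t := fun t ht => rlResolvent_of_pos ht
  set ρ := (x₀ / x) ^ (α - 1) with hρ
  have hρ0 : 0 < ρ := Real.rpow_pos_of_pos (div_pos hx₀ hx) _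
  have hρx : ρ * x ^ (α - 1) = x₀ ^ (α - 1) := by
    rw [hρ, ← Real.mul_rpow (div_pos hx₀ hx).le hx.le, div_mul_cancel₀ _ hx.ne']
  have hshift : ∀ t, rlKernel 1 (t - x) * k (x₀ - t) =
      (fun s => rlKernel 1 s * k (x₀ - x - s)) (t - x) := fun t => by
    simp only; congr 2; ring
  have hpt : ∀ t, t ≠ x → R t * k (x₀ - t) ≤
      ρ * (R t * k (x - t)) + F x * x ^ (α - 1) * (rlKernel 1 (t - x) * k (x₀ - t)) := by
    intro t htx
    rcases le_or_gt t 0 with ht | ht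
    · have h1 : rlKernel 1 (t - x) = 0 := rlKernel_of_nonpos (by linarith)
      simp [hR, rlResolvent_of_nonpos ht, h1]
    rcases le_or_gt x₀ t with hxt | hxt
    · simp [hk, rlKernel_of_nonpos (sub_nonpos.2 hxt),
        rlKernel_of_nonpos (sub_nonpos.2 (hxx.le.trans hxt))]
    have hk0 : 0 < k (x₀ - t) := rlKernel_pos hα.1 (sub_pos.2 hxt)
    rw [hRF t ht]
    have hFt : 0 < F t := hpos t ⟨ht.le, hxt⟩
    have htα : 0 < t ^ (α - 1) := Real.rpow_pos_of_pos ht _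
    rcases lt_or_gt_of_ne htx with h | h
    · have h1 : rlKernel 1 (t - x) = 0 := rlKernel_of_nonpos (by linarith)
      have h2 : k (x₀ - t) ≤ ρ * k (x - t) := by
        rw [hk, rlKernel_of_pos (sub_pos.2 hxt), rlKernel_of_pos (sub_pos.2 h), mul_div_assoc', hρ,
          ← Real.mul_rpow (div_pos hx₀ hx).le (sub_pos.2 h).le]
        refine div_le_div_of_nonneg_right (Real.rpow_le_rpow_of_nonpos
          (mul_pos (div_pos hx₀ hx) (sub_pos.2 h)) ?_ (by linarith [hα.2]))
          (Real.Gamma_pos_of_pos hα.1).le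
        rw [div_mul_eq_mul_div, div_le_iff₀ hx]
        nlinarith
      rw [h1, zero_mul, mul_zero, add_zero, mul_left_comm]
      exact mul_le_mul_of_nonneg_left h2 (by positivity)
    · have h1 : rlKernel 1 (t - x) = 1 := by
        rw [rlKernel_of_pos (sub_pos.2 h)]; simp
      rw [h1, one_mul, hk, rlKernel_of_nonpos (p := α) (sub_nonpos.2 h.le), mul_zero, mul_zero,
        zero_add]
      refine mul_le_mul_of_nonneg_right ?_ hk0.le
      rw [mul_comm]
      exact mul_le_mul (hmax t ⟨h.le, hxt.le⟩)
        (Real.rpow_le_rpow_of_nonpos hx h.le (by linarith [hα.2])) htα.le hFx.le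
  have hi1 := (integrable_rlResolvent_mul_rlKernel hα (-K) x).const_mul ρ
  have hi2 : Integrable fun t => F x * x ^ (α - 1) * (rlKernel 1 (t - x) * k (x₀ - t)) := by
    simp_rw [hshift]
    exact ((integrable_rlKernel_mul_rlKernel one_pos hα.1 (x₀ - x)).comp_sub_right x).const_mul _
  have hint : conv R k x₀ ≤
      ρ * conv R k x + F x * x ^ (α - 1) * rlKernel (1 + α) (x₀ - x) := by
    have h1 : ∫ t, rlKernel 1 (t - x) * k (x₀ - t) = rlKernel (1 + α) (x₀ - x) := by
      simp_rw [hshift]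
      rw [integral_sub_right_eq_self (fun s => rlKernel 1 s * k (x₀ - x - s)) x,
        ← conv_rlKernel one_pos hα.1]
      rfl
    calc conv R k x₀ ≤ ∫ t, (ρ * (R t * k (x - t)) +
          F x * x ^ (α - 1) * (rlKernel 1 (t - x) * k (x₀ - t))) := by
          refine integral_mono_ae (integrable_rlResolvent_mul_rlKernel hα (-K) x₀) (hi1.add hi2) ?_
          filter_upwards [compl_mem_ae_iff.2 (measure_singleton (μ := volume) x)] with t ht
          exact hpt t ht
      _ = _ := by
          rw [integral_add hi1 hi2, integral_const_mul, integral_const_mul, h1]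
          rfl
  have e0 := rlResolvent_eq hα (-K) x₀
  have e1 := rlResolvent_eq hα (-K) x
  rw [← hR, ← hk] at e0 e1
  have hR0 : R x₀ ≤ 0 := by
    rw [hRF x₀ hx₀]
    exact mul_nonpos_of_nonneg_of_nonpos (Real.rpow_pos_of_pos hx₀ _).le h₀
  have hkk : ρ * k x = k x₀ := by
    rw [hk, rlKernel_of_pos hx, rlKernel_of_pos hx₀, mul_div_assoc', hρx]
  have hRx : ρ * R x = x₀ ^ (α - 1) * F x := by rw [hRF x hx, ← mul_assoc, hρx]
  have hmul := mul_le_mul_of_nonneg_left hint hK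
  refine le_of_mul_le_mul_right ?_ hFx
  rw [← hRx, e1]
  linear_combination hmul - e0 + hR0 + hkk

/-- Positivity of `E_{α,α}` on the negative half-line. -/
lemma mittagLeffler2_neg_pos (hα : α ∈ Ioo (0 : ℝ) 1) (hK : 0 ≤ K) {x : ℝ} (hx : 0 ≤ x) :
    0 < mittagLeffler2 α α (-K * x ^ α) := by
  have hα0 := hα.1
  set F : ℝ → ℝ := fun t => mittagLeffler2 α α (-K * t ^ α) with hF
  have hc : Continuous F :=
    (continuous_mittagLeffler2 hα hα.1).comp ((Real.continuous_rpow_const hα.1.le).const_mul (-K))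
  have hF0 : 0 < F 0 := by
    simp only [hF, Real.zero_rpow hα0.ne', mul_zero, mittagLeffler2_zero]
    exact one_div_pos.2 (Real.Gamma_pos_of_pos hα0)
  by_contra! hneg
  obtain ⟨x₀, ⟨⟨hx₀, -⟩, hFx₀⟩, hleast⟩ :=
    (isCompact_Icc.inter_right (isClosed_Iic.preimage hc)).exists_isLeast
      (s := Icc 0 x ∩ F ⁻¹' Iic 0) ⟨x, ⟨hx, le_rfl⟩, hneg⟩
  rw [mem_preimage, mem_Iic] at hFx₀
  have hx₀' : 0 < x₀ := hx₀.lt_of_ne fun h => by rw [← h] at hFx₀; linarith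
  have hpos : ∀ t ∈ Ico 0 x₀, 0 < F t := fun t ht => by
    by_contra! h
    have hxx : x₀ ≤ x := hleast ⟨⟨hx, le_rfl⟩, hneg⟩
    exact absurd (hleast ⟨⟨ht.1, ht.2.le.trans hxx⟩, h⟩) (not_le.2 ht.2)
  have hlim : Tendsto (fun t => K * t ^ (α - 1) * ((x₀ - t) ^ α / Real.Gamma (1 + α)))
      (𝓝 x₀) (𝓝 0) := by
    have : ContinuousAt (fun t => K * t ^ (α - 1) * ((x₀ - t) ^ α / Real.Gamma (1 + α))) x₀ := by
      refine (continuousAt_const.mul (Real.continuousAt_rpow_const _ _ (.inl hx₀'.ne'))).mul ?_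
      exact ((continuousAt_const.sub continuousAt_id).rpow_const (.inr hα0.le)).div_const _
    simpa [ContinuousAt, Real.zero_rpow hα0.ne'] using this
  obtain ⟨δ, hδ, hball⟩ := Metric.eventually_nhds_iff.1
    ((hlim.eventually_lt_const (Real.rpow_pos_of_pos hx₀' (α - 1))).and (lt_mem_nhds hx₀'))
  have hdist : ∀ t ∈ Icc (x₀ - δ / 2) x₀, dist t x₀ < δ := fun t ht => by
    rw [Real.dist_eq, abs_lt]; constructor <;> linarith [ht.1, ht.2]
  obtain ⟨y, hy, hymax⟩ := isCompact_Icc.exists_isMaxOn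
    (nonempty_Icc.2 (show x₀ - δ / 2 ≤ x₀ by linarith)) hc.continuousOn
  have hleft : x₀ - δ / 2 ∈ Icc (x₀ - δ / 2) x₀ := ⟨le_rfl, by linarith⟩
  have hFy : 0 < F y :=
    (hpos _ ⟨(hball (hdist _ hleft)).2.le, by linarith⟩).trans_le (hymax hleft)
  have hyx : y < x₀ := hy.2.lt_of_ne fun h => by rw [h] at hFy; linarith
  have hlt := (hball (hdist y hy)).1
  have hle := rpow_le_of_isMaxOn hα hK (hball (hdist y hy)).2 hyx hpos hFx₀
    fun t ht => hymax ⟨hy.1.trans ht.1, ht.2⟩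
  rw [rlKernel_of_pos (sub_pos.2 hyx), add_sub_cancel_left] at hle
  exact absurd hlt (not_lt.2 hle)

lemma rlResolvent_neg_nonneg (hα : α ∈ Ioo (0 : ℝ) 1) (hK : 0 ≤ K) (x : ℝ) :
    0 ≤ rlResolvent α (-K) x := by
  rcases le_or_gt x 0 with hx | hx
  · rw [rlResolvent_of_nonpos hx]
  · rw [rlResolvent_of_pos hx]
    exact mul_nonneg (Real.rpow_nonneg hx.le _) (mittagLeffler2_neg_pos hα hK hx.le).le

lemma rlResolvent_neg_le (hα : α ∈ Ioo (0 : ℝ) 1) (hK : 0 ≤ K) (x : ℝ) :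
    rlResolvent α (-K) x ≤ rlKernel α x := by
  have h : 0 ≤ conv (rlResolvent α (-K)) (rlKernel α) x := integral_nonneg fun t =>
    mul_nonneg (rlResolvent_neg_nonneg hα hK t) (rlKernel_nonneg hα.1 _)
  rw [rlResolvent_eq hα]
  nlinarith

lemma kernelBounded_rlResolvent_neg (hα : α ∈ Ioo (0 : ℝ) 1) (hK : 0 ≤ K) :
    KernelBounded α 1 (rlResolvent α (-K)) where
  aestronglyMeasurable := (measurable_rlResolvent hα _).aestronglyMeasurable
  abs_le x := by
    rw [abs_of_nonneg (rlResolvent_neg_nonneg hα hK x), one_mul]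
    exact rlResolvent_neg_le hα hK x

end Positivity

section Comparison

variable {α K C D T : ℝ} {u f h : ℝ → ℝ}

/-- Variation of constants: the solution of `u = k + f * k` in terms of the resolvent of `-K k`. -/
lemma eq_rlResolvent_add_conv (hα : α ∈ Ioo (0 : ℝ) 1) (hK : 0 ≤ K) (hu : KernelBounded α C u)
    (hf : KernelBounded α D f)
    (heq : ∀ x ≤ T, u x = rlKernel α x + conv f (rlKernel α) x) {x : ℝ} (hx : x ≤ T) :
    u x = rlResolvent α (-K) x +
      conv (fun t => f t + K * u t) (rlResolvent α (-K)) x := by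
  have hα0 := hα.1
  set R := rlResolvent α (-K)
  set k := rlKernel α
  have hR : KernelBounded α 1 R := kernelBounded_rlResolvent_neg hα hK
  have hk : KernelBounded α 1 k := kernelBounded_rlKernel hα0
  have hkR : ∀ x, K * conv k R x = k x - R x := fun x => by
    have := rlResolvent_eq hα (-K) x
    rw [conv_comm k R]
    linear_combination this
  have h1 : conv u R x = conv k R x + conv f (conv k R) x := by
    rw [← hf.conv_assoc hα0 hα0 hα0 hk hR]
    calc conv u R x = ∫ t, (k t * R (x - t) + conv f k t * R (x - t)) := by
          refine integral_congr_ae (.of_forall fun t => ?_)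
          simp only
          rcases le_or_gt t T with ht | ht
          · rw [heq t ht, add_mul]
          · simp [hR.eq_zero (show x - t ≤ 0 by linarith)]
      _ = _ := integral_add (hk.integrable hα0 hα0 hR x)
          ((hf.conv hα0 hα0 hk).integrable (add_pos hα0 hα0) hα0 hR x)
  have h2 : K * conv f (conv k R) x = conv f k x - conv f R x := by
    rw [conv, conv, conv, ← integral_const_mul,
      ← integral_sub (hf.integrable hα0 hα0 hk x) (hf.integrable hα0 hα0 hR x)]
    refine integral_congr_ae (.of_forall fun t => ?_)
    simp only
    rw [mul_left_comm, hkR, mul_sub]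
  have h3 : conv (fun t => f t + K * u t) R x = conv f R x + K * conv u R x := by
    rw [conv, conv, conv, ← integral_const_mul,
      ← integral_add (hf.integrable hα0 hα0 hR x) ((hu.integrable hα0 hα0 hR x).const_mul K)]
    refine integral_congr_ae (.of_forall fun t => ?_)
    simp only
    ring
  rw [h3, h1, mul_add, hkR, h2, heq x hx]
  ring

/-- Comparison principle: a solution of `u = k + (h u) * k` on `(0, T]` with `|h| ≤ K` dominates the
solution with constant coefficient `-K`. -/
lemma rlResolvent_neg_le_of_eq (hα : α ∈ Ioo (0 : ℝ) 1) (hK : 0 ≤ K) (hu : KernelBounded α C u)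
    (huT : ∀ x, T < x → u x = 0) (hh : AEStronglyMeasurable h) (hhK : ∀ x, |h x| ≤ K)
    (heq : ∀ x ≤ T, u x = rlKernel α x + conv (fun t => h t * u t) (rlKernel α) x)
    {x : ℝ} (hx : x ≤ T) : rlResolvent α (-K) x ≤ u x := by
  have hα0 := hα.1
  have hf : KernelBounded α (K * C) fun t => h t * u t := hu.mul_of_abs_le hh hhK
  have hR := kernelBounded_rlResolvent_neg hα hK
  have hR0 := rlResolvent_neg_nonneg hα hK
  have hk0 : ∀ x, 0 ≤ rlKernel α x := rlKernel_nonneg hα0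
  have hrep := fun x (hx : x ≤ T) => eq_rlResolvent_add_conv hα hK hu hf heq hx
  have hp := hf.add (hu.mul_of_abs_le (g := fun _ => K) aestronglyMeasurable_const
    fun _ => (abs_of_nonneg hK).le)
  have hp0 : ∀ t, 0 ≤ h t + K := fun t => by linarith [neg_le_of_abs_le (hhK t)]
  have hp2 : ∀ t, h t + K ≤ 2 * K := fun t => by linarith [le_of_abs_le (hhK t)]
  let z : ℝ → ℝ := fun x => max (-u x) 0
  have hz0 : ∀ x, 0 ≤ z x := fun x => le_max_right _ _
  have hzC : ∀ x, z x ≤ C * rlKernel α x := fun x =>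
    max_le ((neg_le_abs _).trans (hu.2 x)) ((abs_nonneg _).trans (hu.2 x))
  have hz : KernelBounded α C z :=
    ⟨hu.1.neg.sup aestronglyMeasurable_const, fun x => by rw [abs_of_nonneg (hz0 x)]; exact hzC x⟩
  have hu0 : ∀ x, 0 ≤ u x := by
    have hgr := fun x => le_rlResolvent_of_le_conv (c := 0) hα (mul_nonneg zero_le_two hK)
      hz0 hzC (fun x => ?_) x
    · intro x
      have h1 := hgr x
      have h2 : -u x ≤ z x := le_max_left _ _
      linarith
    have hc0 : 0 ≤ conv z (rlKernel α) x :=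
      integral_nonneg fun t => mul_nonneg (hz0 t) (hk0 _)
    rw [zero_mul, zero_add]
    refine max_le ?_ (by positivity)
    rcases lt_or_ge T x with hxT | hxT
    · rw [huT x hxT]; simp; positivity
    rw [hrep x hxT, neg_add]
    refine (add_le_of_nonpos_left (neg_nonpos.2 (hR0 x))).trans ?_
    rw [conv, conv, ← integral_const_mul, ← integral_neg]
    refine integral_mono (hp.integrable hα0 hα0 hR x).neg
      ((hz.integrable hα0 hα0 (kernelBounded_rlKernel hα0) x).const_mul _) fun t => ?_
    simp only
    have hRk := rlResolvent_neg_le hα hK (x - t)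
    calc -((h t * u t + K * u t) * rlResolvent α (-K) (x - t))
        = (h t + K) * -u t * rlResolvent α (-K) (x - t) := by ring
      _ ≤ (h t + K) * z t * rlResolvent α (-K) (x - t) := by
          gcongr
          · exact hR0 _
          · exact hp0 t
          · exact le_max_left _ _
      _ ≤ 2 * K * z t * rlKernel α (x - t) := by
          have := hp2 t
          have := hz0 t
          have := hR0 (x - t)
          gcongr
      _ = _ := by ring
  rw [hrep x hx]
  refine le_add_of_nonneg_right (integral_nonneg fun t => mul_nonneg ?_ (hR0 _))
  change 0 ≤ h t * u t + K * u t
  rw [← add_mul]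
  exact mul_nonneg (hp0 t) (hu0 t)

end Comparison

section Algebra

variable {𝔸 : Type*} [NormedRing 𝔸] [NormedAlgebra ℝ 𝔸] {α C M T c : ℝ} {a : 𝔸} {ψ : ℝ → 𝔸}
  {γ : ℝ → ℝ}

lemma integrable_rlKernel_smul (hα : 0 < α) (hψm : AEStronglyMeasurable ψ)
    (hψ : ∀ x, ‖ψ x‖ ≤ C * rlKernel α x) (hγm : AEStronglyMeasurable γ) (hγ : ∀ x, |γ x| ≤ M)
    (x : ℝ) : Integrable fun t => rlKernel α (x - t) • γ t • (a * ψ t) := by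
  refine ((integrable_rlKernel_mul_rlKernel hα hα x).const_mul (M * ‖a‖ * C)).mono' ?_
    (.of_forall fun t => ?_)
  · exact ((measurable_rlKernel α).comp
      (measurable_const.sub measurable_id)).aestronglyMeasurable.smul
        (hγm.smul (aestronglyMeasurable_const.mul hψm))
  · rw [norm_smul, norm_smul, Real.norm_of_nonneg (rlKernel_nonneg hα _), Real.norm_eq_abs]
    have hM : 0 ≤ M := (abs_nonneg _).trans (hγ 0)
    have hk := rlKernel_nonneg hα (x - t)
    calc rlKernel α (x - t) * (|γ t| * ‖a * ψ t‖)
        ≤ rlKernel α (x - t) * (M * (‖a‖ * (C * rlKernel α t))) := by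
          have h : ‖a * ψ t‖ ≤ ‖a‖ * (C * rlKernel α t) := (norm_mul_le _ _).trans
            (mul_le_mul_of_nonneg_left (hψ t) (norm_nonneg _))
          gcongr
          exact hγ t
      _ = _ := by ring

/-- Upper bound for the solution of `ψ = k 1 + (γ a ψ) * k` on `(0, T]`. -/
lemma norm_le_rlResolvent (hα : α ∈ Ioo (0 : ℝ) 1) (h1 : ‖(1 : 𝔸)‖ ≤ 1)
    (hψm : AEStronglyMeasurable ψ) (hψ : ∀ x, ‖ψ x‖ ≤ C * rlKernel α x)
    (hψT : ∀ x, T < x → ψ x = 0) (hγ : ∀ x, |γ x| ≤ M) (ha : ‖a‖ ≤ c)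
    (heq : ∀ x ∈ Ioc 0 T, ψ x = rlKernel α x • (1 : 𝔸) +
      ∫ t, rlKernel α (x - t) • γ t • (a * ψ t)) (x : ℝ) :
    ‖ψ x‖ ≤ rlResolvent α (c * M) x := by
  have hα0 := hα.1
  have hM : 0 ≤ M := (abs_nonneg _).trans (hγ 0)
  have hc : 0 ≤ c := (norm_nonneg _).trans ha
  have hy : KernelBounded α C fun x => ‖ψ x‖ := ⟨hψm.norm, fun x => by simpa using hψ x⟩
  rw [← one_mul (rlResolvent _ _ _)]
  refine le_rlResolvent_of_le_conv hα (mul_nonneg hc hM) (fun x => norm_nonneg _) hψ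
    (fun x => ?_) x
  have hconv : 0 ≤ conv (fun x => ‖ψ x‖) (rlKernel α) x :=
    integral_nonneg fun t => mul_nonneg (norm_nonneg _) (rlKernel_nonneg hα0 _)
  have hk := rlKernel_nonneg hα0 x
  by_cases hx : x ∈ Ioc 0 T
  · rw [heq x hx]
    refine (norm_add_le _ _).trans (add_le_add ?_ ?_)
    · rw [norm_smul, Real.norm_of_nonneg hk, mul_comm]
      exact mul_le_mul_of_nonneg_right h1 hk
    · rw [conv, ← integral_const_mul]
      refine norm_integral_le_of_norm_le
        ((hy.integrable hα0 hα0 (kernelBounded_rlKernel hα0) x).const_mul _)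
        (.of_forall fun t => ?_)
      have hk := rlKernel_nonneg hα0 (x - t)
      rw [norm_smul, norm_smul, Real.norm_of_nonneg hk, Real.norm_eq_abs]
      calc rlKernel α (x - t) * (|γ t| * ‖a * ψ t‖)
          ≤ rlKernel α (x - t) * (M * (c * ‖ψ t‖)) := by
            have h : ‖a * ψ t‖ ≤ c * ‖ψ t‖ := (norm_mul_le _ _).trans
              (mul_le_mul_of_nonneg_right ha (norm_nonneg _))
            gcongr
            exact hγ t
        _ = _ := by ring
  · have h0 : ψ x = 0 := by
      rcases lt_or_ge T x with h | h
      · exact hψT x h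
      · have hx0 : x ≤ 0 := not_lt.1 fun h' => hx ⟨h', h⟩
        simpa [rlKernel_of_nonpos hx0] using hψ x
    rw [h0, norm_zero]
    positivity

/-- Lower bound for the solution of `ψ = k 1 + (γ a ψ) * k` on `(0, T]` through a functional
which is an eigenvector of left multiplication by `a`. -/
lemma rlResolvent_neg_le_apply [CompleteSpace 𝔸] (hα : α ∈ Ioo (0 : ℝ) 1)
    (hψm : AEStronglyMeasurable ψ) (hψ : ∀ x, ‖ψ x‖ ≤ C * rlKernel α x)
    (hψT : ∀ x, T < x → ψ x = 0) (hγm : AEStronglyMeasurable γ) (hγ : ∀ x, |γ x| ≤ M)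
    (heq : ∀ x ∈ Ioc 0 T, ψ x = rlKernel α x • (1 : 𝔸) +
      ∫ t, rlKernel α (x - t) • γ t • (a * ψ t))
    (L : 𝔸 →L[ℝ] ℝ) {lam : ℝ} (hL : ∀ b, L (a * b) = lam * L b) (hL1 : L 1 = 1) (hlam : |lam| ≤ c)
    {x : ℝ} (hx : x ≤ T) : rlResolvent α (-(c * M)) x ≤ L (ψ x) := by
  have hα0 := hα.1
  have hM : 0 ≤ M := (abs_nonneg _).trans (hγ 0)
  have hc : 0 ≤ c := (abs_nonneg _).trans hlam
  have hu : KernelBounded α (‖L‖ * C) fun x => L (ψ x) :=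
    ⟨L.continuous.comp_aestronglyMeasurable hψm, fun x => by
      rw [mul_assoc]
      exact (L.le_opNorm _).trans (mul_le_mul_of_nonneg_left (hψ x) (norm_nonneg _))⟩
  refine rlResolvent_neg_le_of_eq (h := fun t => lam * γ t) hα (mul_nonneg hc hM) hu
    (fun x hx => by rw [hψT x hx, map_zero]) (hγm.const_mul lam) (fun t => ?_) (fun y hy => ?_) hx
  · rw [abs_mul]
    exact mul_le_mul hlam (hγ t) (abs_nonneg _) hc
  · rcases le_or_gt y 0 with hy0 | hy0
    · rw [hu.eq_zero hy0, rlKernel_of_nonpos hy0, conv_of_nonpos (fun t ht => ?_)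
        (fun t => rlKernel_of_nonpos) hy0, add_zero]
      rw [hu.eq_zero ht, mul_zero]
    · rw [heq y ⟨hy0, hy⟩, map_add, map_smul, hL1, smul_eq_mul, mul_one,
        ← L.integral_comp_comm (integrable_rlKernel_smul hα0 hψm hψ hγm hγ y)]
      congr 1
      refine integral_congr_ae (.of_forall fun t => ?_)
      simp only [map_smul, hL, smul_eq_mul]
      ring

end Algebra

section Spectral

open scoped RealInnerProductSpace

variable {n : Type*} [Fintype n] [DecidableEq n] {A : Matrix n n ℝ}

lemma inner_eigenvectorBasis_toEuclideanCLM (hA : A.IsHermitian) (i : n)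
    (x : EuclideanSpace ℝ n) : ⟪hA.eigenvectorBasis i, toEuclideanCLM (𝕜 := ℝ) A x⟫ =
      hA.eigenvalues i * ⟪hA.eigenvectorBasis i, x⟫ := by
  have h := isSymmetric_toEuclideanLin_iff.2 hA (hA.eigenvectorBasis i) x
  have h2 : toEuclideanLin A (hA.eigenvectorBasis i) =
      hA.eigenvalues i • hA.eigenvectorBasis i := by
    ext j
    exact congrFun (hA.mulVec_eigenvectorBasis i) j
  rw [h2, real_inner_smul_left] at h
  exact h.symm

lemma norm_toEuclideanCLM_le (hA : A.IsHermitian) {c : ℝ} (hc : 0 ≤ c)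
    (h : ∀ i, |hA.eigenvalues i| ≤ c) : ‖toEuclideanCLM (𝕜 := ℝ) A‖ ≤ c := by
  refine ContinuousLinearMap.opNorm_le_bound _ hc fun x => ?_
  refine (sq_le_sq₀ (norm_nonneg _) (by positivity)).1 ?_
  rw [mul_pow, ← hA.eigenvectorBasis.repr.norm_map, ← hA.eigenvectorBasis.repr.norm_map x,
    EuclideanSpace.norm_sq_eq, EuclideanSpace.norm_sq_eq, Finset.mul_sum]
  refine Finset.sum_le_sum fun i _ => ?_
  rw [OrthonormalBasis.repr_apply_apply, OrthonormalBasis.repr_apply_apply,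
    inner_eigenvectorBasis_toEuclideanCLM, norm_mul, mul_pow]
  have := h i
  rw [← Real.norm_eq_abs] at this
  gcongr

end Spectral

/-- The right Riemann–Liouville integral as an integral over the line against `rlKernel`. -/
lemma smul_integral_sub_rpow_smul {V : Type*} [NormedAddCommGroup V] [NormedSpace ℝ V]
    (α t₀ : ℝ) {x T : ℝ} (hx : x ∈ Ioc 0 T) (F : ℝ → V) :
    (1 / Real.Gamma α) • ∫ s in (t₀ - x)..t₀, (s - (t₀ - x)) ^ (α - 1) • F s =
      ∫ t, rlKernel α (x - t) • (Ioc 0 T).indicator (fun t => F (t₀ - t)) t := by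
  have h := intervalIntegral.integral_comp_sub_left (a := 0) (b := x)
    (fun s => (s - (t₀ - x)) ^ (α - 1) • F s) t₀
  rw [sub_zero] at h
  rw [← h, intervalIntegral.integral_of_le hx.1.le, integral_Ioc_eq_integral_Ioo,
    ← integral_smul, ← integral_indicator measurableSet_Ioo]
  congr 1 with t
  by_cases ht : t ∈ Ioo 0 x
  · rw [indicator_of_mem ht, indicator_of_mem (mem_Ioc.2 ⟨ht.1, ht.2.le.trans hx.2⟩),
      rlKernel_of_pos (sub_pos.2 ht.2), smul_smul]
    congr 1
    rw [sub_sub_sub_cancel_left]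
    ring
  · rw [indicator_of_notMem ht]
    rcases le_or_gt t 0 with h0 | h0
    · rw [indicator_of_notMem (fun h' => not_lt.2 h0 h'.1), smul_zero]
    · rw [rlKernel_of_nonpos (sub_nonpos.2 (not_lt.1 fun h' => ht ⟨h0, h'⟩)), zero_smul]

/-- two-sided bounds
`E_{α,α}(-λ_max M (t₀-a)^α) ≤ ‖(t₀-τ)^{1-α}Φ(τ)‖ ≤ E_{α,α}(λ_max M (t₀-a)^α)` for the
solution of the right Riemann–Liouville matrix Volterra equation
`Φ(τ) = (t₀-τ)^{α-1}/Γ(α)·𝕀 + (1/Γ(α)) ∫_τ^{t₀} (s-τ)^{α-1} g(s) A Φ(s) ds`, with `A`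
symmetric, `λ_max = max_i |λ_i|`, and `|g| ≤ M`. -/
theorem rl_transition_matrix_bounds_symm
    (d : ℕ) (α a t₀ M lmax : ℝ) (hα : α ∈ Set.Ioo (0:ℝ) 1) (hat : a < t₀)
    (A : Matrix (Fin d) (Fin d) ℝ) (hA : A.IsHermitian)
    (hlmax_mem : ∃ i, |hA.eigenvalues i| = lmax)
    (hlmax_max : ∀ i, |hA.eigenvalues i| ≤ lmax)
    (hM : 0 ≤ M) (g : ℝ → ℝ) (hg : ContinuousOn g (Set.Icc a t₀))
    (hgb : ∀ s ∈ Set.Icc a t₀, |g s| ≤ M)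
    (Φ : ℝ → Matrix (Fin d) (Fin d) ℝ)
    (hΦ : ∀ τ ∈ Set.Ico a t₀,
      Φ τ = ((t₀ - τ) ^ (α - 1) / Real.Gamma α) • (1 : Matrix (Fin d) (Fin d) ℝ)
        + (1 / Real.Gamma α) • ∫ s in τ..t₀, (s - τ) ^ (α - 1) • (g s • (A * Φ s)))
    (Φe : ℝ → Matrix (Fin d) (Fin d) ℝ) (hΦe : ContinuousOn Φe (Set.Icc a t₀))
    (hext : ∀ τ ∈ Set.Ico a t₀, Φe τ = (t₀ - τ) ^ (1 - α) • Φ τ) :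
    ∀ τ ∈ Set.Ico a t₀,
      mittagLeffler2 α α (-(lmax * M * (t₀ - a) ^ α)) ≤
        ‖Matrix.toEuclideanCLM (𝕜 := ℝ) ((t₀ - τ) ^ (1 - α) • Φ τ)‖ ∧
      ‖Matrix.toEuclideanCLM (𝕜 := ℝ) ((t₀ - τ) ^ (1 - α) • Φ τ)‖ ≤
        mittagLeffler2 α α (lmax * M * (t₀ - a) ^ α) := by
  intro τ hτ
  have hα0 := hα.1
  have hΓ := Real.Gamma_pos_of_pos hα0
  obtain ⟨i, hi⟩ := hlmax_mem
  have hl : 0 ≤ lmax := hi ▸ abs_nonneg _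
  set T := t₀ - a with hT
  have hT0 : 0 < T := sub_pos.2 hat
  set x := t₀ - τ with hx
  have hxT : x ∈ Ioc 0 T := ⟨sub_pos.2 hτ.2, sub_le_sub_left hτ.1 _⟩
  have hmem : ∀ y ∈ Ioc 0 T, t₀ - y ∈ Ico a t₀ := fun y hy => by
    constructor <;> linarith [hy.1, hy.2]
  have hmaps : MapsTo (fun y => t₀ - y) (Icc 0 T) (Icc a t₀) := fun y hy => by
    constructor <;> linarith [hy.1, hy.2]
  have hcts : ContinuousOn (fun y : ℝ => t₀ - y) (Icc 0 T) := by fun_prop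
  let P : Matrix (Fin d) (Fin d) ℝ ≃L[ℝ]
      (EuclideanSpace ℝ (Fin d) →L[ℝ] EuclideanSpace ℝ (Fin d)) :=
    (toEuclideanCLM (n := Fin d) (𝕜 := ℝ)).toAlgEquiv.toLinearEquiv.toContinuousLinearEquiv
  have hP : ∀ B, P B = toEuclideanCLM (𝕜 := ℝ) B := fun _ => rfl
  have hPmul : ∀ B B', P (B * B') = P B * P B' := fun B B' => map_mul (toEuclideanCLM (𝕜 := ℝ)) B B'
  have hP1 : P 1 = 1 := map_one (toEuclideanCLM (n := Fin d) (𝕜 := ℝ))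
  have hPint : ∀ F : ℝ → Matrix (Fin d) (Fin d) ℝ, P (∫ t, F t) = ∫ t, P (F t) := fun F =>
    (P.integral_comp_comm F).symm
  set ψ := (Ioc 0 T).indicator fun y => P (Φ (t₀ - y)) with hψdef
  set γ := (Icc 0 T).indicator fun y => g (t₀ - y) with hγdef
  have hΦeq : ∀ y ∈ Ioc 0 T, Φ (t₀ - y) = y ^ (α - 1) • Φe (t₀ - y) := fun y hy => by
    rw [hext _ (hmem y hy), sub_sub_cancel, smul_smul, ← Real.rpow_add hy.1]
    simp
  have hψe : ψ = (Ioc 0 T).indicator fun y => y ^ (α - 1) • P (Φe (t₀ - y)) :=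
    indicator_congr fun y hy => by rw [hΦeq y hy, map_smul]
  have hPe : ContinuousOn (fun y => P (Φe (t₀ - y))) (Icc 0 T) :=
    P.continuous.comp_continuousOn (hΦe.comp hcts hmaps)
  obtain ⟨C, hC⟩ := isCompact_Icc.exists_bound_of_continuousOn hPe
  have hψm : AEStronglyMeasurable ψ := by
    rw [hψe, aestronglyMeasurable_indicator_iff measurableSet_Ioc]
    have hm : Measurable fun y : ℝ => y ^ (α - 1) := by fun_prop
    exact hm.aestronglyMeasurable.smul
      ((hPe.mono Ioc_subset_Icc_self).aestronglyMeasurable measurableSet_Ioc)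
  have hψb : ∀ y, ‖ψ y‖ ≤ C * Real.Gamma α * rlKernel α y := fun y => by
    by_cases hy : y ∈ Ioc 0 T
    · rw [hψe, indicator_of_mem hy, rlKernel_of_pos hy.1, norm_smul,
        Real.norm_of_nonneg (Real.rpow_nonneg hy.1.le _), mul_assoc, mul_div_cancel₀ _ hΓ.ne',
        mul_comm]
      exact mul_le_mul_of_nonneg_right (hC y ⟨hy.1.le, hy.2⟩) (Real.rpow_nonneg hy.1.le _)
    · have hC0 : 0 ≤ C := (norm_nonneg _).trans (hC 0 ⟨le_rfl, hT0.le⟩)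
      rw [hψdef, indicator_of_notMem hy, norm_zero]
      exact mul_nonneg (mul_nonneg hC0 hΓ.le) (rlKernel_nonneg hα0 _)
  have hψT : ∀ y, T < y → ψ y = 0 := fun y hy => indicator_of_notMem (fun h => not_lt.2 h.2 hy) _
  have hγm : AEStronglyMeasurable γ := by
    rw [hγdef, aestronglyMeasurable_indicator_iff measurableSet_Icc]
    exact (hg.comp hcts hmaps).aestronglyMeasurable measurableSet_Icc
  have hK : M ≤ M * (T / x) ^ α := le_mul_of_one_le_right hM
    (Real.one_le_rpow ((one_le_div hxT.1).2 hxT.2) hα0.le)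
  have hγ : ∀ y, |γ y| ≤ M * (T / x) ^ α := fun y => by
    refine le_trans ?_ hK
    by_cases hy : y ∈ Icc 0 T
    · rw [hγdef, indicator_of_mem hy]
      exact hgb _ (hmaps hy)
    · rw [hγdef, indicator_of_notMem hy, abs_zero]
      exact hM
  have heq : ∀ y ∈ Ioc 0 T, ψ y = rlKernel α y • 1 +
      ∫ t, rlKernel α (y - t) • γ t • (P A * ψ t) := fun y hy => by
    rw [hψdef, indicator_of_mem hy, hΦ _ (hmem y hy), smul_integral_sub_rpow_smul α t₀ hy,
      map_add, map_smul, hP1, sub_sub_cancel, rlKernel_of_pos hy.1, hPint]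
    congr 2 with t : 1
    rw [map_smul]
    congr 1
    by_cases ht : t ∈ Ioc 0 T
    · rw [indicator_of_mem ht, indicator_of_mem ht, hγdef,
        indicator_of_mem (Ioc_subset_Icc_self ht), map_smul, hPmul]
    · rw [indicator_of_notMem ht, indicator_of_notMem ht, map_zero, mul_zero, smul_zero]
  have hscale : lmax * (M * (T / x) ^ α) * x ^ α = lmax * M * T ^ α := by
    rw [Real.div_rpow hT0.le hxT.1.le]
    have := (Real.rpow_pos_of_pos hxT.1 α).ne'
    field_simp
  have hinv : x ^ (1 - α) * x ^ (α - 1) = 1 := by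
    rw [← Real.rpow_add hxT.1]
    simp
  have hx0 : 0 ≤ x ^ (1 - α) := Real.rpow_nonneg hxT.1.le _
  have hnorm : ‖toEuclideanCLM (𝕜 := ℝ) (x ^ (1 - α) • Φ τ)‖ = x ^ (1 - α) * ‖ψ x‖ := by
    rw [hψdef, indicator_of_mem hxT, ← hP, map_smul, norm_smul, Real.norm_of_nonneg hx0, hx,
      sub_sub_cancel]
  have hres : ∀ z, x ^ (1 - α) * rlResolvent α z x = mittagLeffler2 α α (z * x ^ α) := fun z => by
    rw [rlResolvent_of_pos hxT.1, ← mul_assoc, hinv, one_mul]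
  rw [hnorm]
  constructor
  · set v := hA.eigenvectorBasis i
    have hv : ‖v‖ = 1 := hA.eigenvectorBasis.orthonormal.1 i
    let L : (EuclideanSpace ℝ (Fin d) →L[ℝ] EuclideanSpace ℝ (Fin d)) →L[ℝ] ℝ :=
      (innerSL ℝ v).comp (ContinuousLinearMap.apply ℝ (EuclideanSpace ℝ (Fin d)) v)
    have hL : ∀ B, L B = inner ℝ v (B v) := fun _ => rfl
    have h := rlResolvent_neg_le_apply hα hψm hψb hψT hγm hγ heq L (lam := hA.eigenvalues i)
      (fun B => inner_eigenvectorBasis_toEuclideanCLM hA i (B v))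
      (by rw [hL, one_apply_eq_self, real_inner_self_eq_norm_sq, hv, one_pow])
      hi.le hxT.2
    rw [← hscale, ← neg_mul, ← hres]
    refine mul_le_mul_of_nonneg_left (h.trans ?_) hx0
    rw [hL]
    refine (real_inner_le_norm _ _).trans ?_
    rw [hv, one_mul]
    simpa [hv] using (ψ x).le_opNorm v
  · rw [← hscale, ← hres]
    exact mul_le_mul_of_nonneg_left (norm_le_rlResolvent hα ContinuousLinearMap.norm_id_le
      hψm hψb hψT hγ (norm_toEuclideanCLM_le hA hl hlmax_max) heq x) hx0
end

section
/- Let α ∈ (0,1), T > 0, let a : [0,T] → ℝ be continuous and let x₀ > 0. If x : [0,T] → ℝ is continuous and satisfies x(t) = x₀ + (1/Γ(α)) ∫₀^t (t−s)^{α−1} a(s) x(s) ds for every t ∈ [0,T], then x(t) > 0 for all t ∈ [0,T]. -/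
open MeasureTheory Set

/-- The truncated Volterra integral `x₀ + ∫₀ˢ (t-σ)^{α-1} g(σ) dσ`. -/
noncomputable def truncatedVolterra (α x₀ : ℝ) (g : ℝ → ℝ) (s t : ℝ) : ℝ :=
  x₀ + ∫ σ in (0:ℝ)..s, (t - σ) ^ (α - 1) * g σ

lemma intervalIntegrable_sub_rpow {α : ℝ} (hα : 0 < α) (t a b : ℝ) :
    IntervalIntegrable (fun σ => (t - σ) ^ (α - 1)) volume a b := by
  simpa using (intervalIntegral.intervalIntegrable_rpow' (a := t - a) (b := t - b)
    (r := α - 1) (by linarith)).comp_sub_left t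

lemma intervalIntegrable_sub_rpow_mul {α : ℝ} (hα : 0 < α) {g : ℝ → ℝ} (hg : Continuous g)
    (t a b : ℝ) :
    IntervalIntegrable (fun σ => (t - σ) ^ (α - 1) * g σ) volume a b :=
  (intervalIntegrable_sub_rpow hα t a b).mul_continuousOn hg.continuousOn

lemma truncatedVolterra_sub {α : ℝ} (hα : 0 < α) (x₀ : ℝ) {g : ℝ → ℝ} (hg : Continuous g)
    (r s t : ℝ) :
    truncatedVolterra α x₀ g s t - truncatedVolterra α x₀ g r t =
      ∫ σ in r..s, (t - σ) ^ (α - 1) * g σ := by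
  rw [truncatedVolterra, truncatedVolterra, add_sub_add_left_eq_sub,
    intervalIntegral.integral_interval_sub_left] <;>
  exact intervalIntegrable_sub_rpow_mul hα hg _ _ _

lemma hasDerivAt_truncatedVolterra {α : ℝ} (hα : 0 < α) (x₀ : ℝ) {g : ℝ → ℝ}
    (hg : Continuous g) {s t : ℝ} (hst : s < t) :
    HasDerivAt (fun s => truncatedVolterra α x₀ g s t) ((t - s) ^ (α - 1) * g s) s := by
  have hcont : ContinuousOn (fun σ => (t - σ) ^ (α - 1) * g σ) (Iio t) := by
    refine ContinuousOn.mul (ContinuousOn.rpow_const (by fun_prop) ?_) hg.continuousOn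
    intro σ hσ
    exact Or.inl (sub_pos.2 hσ).ne'
  refine (intervalIntegral.integral_hasDerivAt_right
    (intervalIntegrable_sub_rpow_mul hα hg t 0 s)
    (hcont.stronglyMeasurableAtFilter isOpen_Iio s hst)
    (hcont.continuousAt (Iio_mem_nhds hst))).const_add x₀

/-- Nonnegative truncated integrals lose at most the factor `((τ-ξ)/(t-ξ))^{1-α}` when the
evaluation time moves from `τ` to a later `t`. -/
lemma truncatedVolterra_mono {α : ℝ} (hα : α ∈ Ioo (0:ℝ) 1) {x₀ : ℝ} (hx₀ : 0 < x₀)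
    {g : ℝ → ℝ} (hg : Continuous g) {ξ τ t : ℝ} (hξ : 0 ≤ ξ) (hξτ : ξ < τ) (hτt : τ ≤ t)
    (hq : ∀ s ∈ Icc 0 ξ, 0 ≤ truncatedVolterra α x₀ g s τ) :
    ((τ - ξ) / (t - ξ)) ^ (1 - α) * truncatedVolterra α x₀ g ξ τ ≤
      truncatedVolterra α x₀ g ξ t := by
  obtain ⟨hα0, hα1⟩ := hα
  have hderiv : ∀ s ≤ ξ, HasDerivAt
      (fun s => truncatedVolterra α x₀ g s t -
        ((τ - s) / (t - s)) ^ (1 - α) * truncatedVolterra α x₀ g s τ)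
      ((t - τ) / (t - s) ^ 2 * (1 - α) * ((τ - s) / (t - s)) ^ (1 - α - 1) *
        truncatedVolterra α x₀ g s τ) s := by
    intro s hs
    have hτs : 0 < τ - s := by linarith
    have hts : 0 < t - s := by linarith
    have hratio : HasDerivAt (fun s => (τ - s) / (t - s)) (-((t - τ) / (t - s) ^ 2)) s := by
      refine (((hasDerivAt_id' s).const_sub τ).fun_div
        ((hasDerivAt_id' s).const_sub t) hts.ne').congr_deriv ?_
      ring
    have hpow := hratio.rpow_const (p := 1 - α) (Or.inl (div_pos hτs hts).ne')
    refine ((hasDerivAt_truncatedVolterra hα0 x₀ hg (by linarith : s < t)).fun_sub (hpow.fun_mul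
      (hasDerivAt_truncatedVolterra hα0 x₀ hg (by linarith : s < τ)))).congr_deriv ?_
    have hcancel : ((τ - s) / (t - s)) ^ (1 - α) * (τ - s) ^ (α - 1) = (t - s) ^ (α - 1) := by
      rw [Real.div_rpow hτs.le hts.le, show α - 1 = -(1 - α) by ring, Real.rpow_neg hτs.le,
        Real.rpow_neg hts.le]
      have := (Real.rpow_pos_of_pos hτs (1 - α)).ne'
      field_simp
    rw [← hcancel]
    ring
  have hmono := monotoneOn_of_deriv_nonneg (convex_Icc 0 ξ)
    (fun s hs => (hderiv s hs.2).continuousAt.continuousWithinAt)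
    (fun s hs => (hderiv s (interior_subset hs).2).differentiableAt.differentiableWithinAt)
    (fun s hs => by
      have hs' := interior_subset hs
      rw [(hderiv s hs'.2).deriv]
      have h1 : 0 ≤ τ - s := by linarith [hs'.2]
      have h2 : 0 ≤ t - s := by linarith
      have h3 : 0 ≤ t - τ := by linarith
      have h4 : 0 ≤ 1 - α := by linarith
      have := hq s hs'
      positivity)
  have hle := hmono (left_mem_Icc.2 hξ) (right_mem_Icc.2 hξ) hξ
  have hzero : 0 ≤ truncatedVolterra α x₀ g 0 t -
      ((τ - 0) / (t - 0)) ^ (1 - α) * truncatedVolterra α x₀ g 0 τ := by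
    have hr : ((τ - 0) / (t - 0)) ^ (1 - α) ≤ 1 := by
      apply Real.rpow_le_one
      · apply div_nonneg <;> linarith
      · apply div_le_one_of_le₀ <;> linarith
      · linarith
    simp only [truncatedVolterra, intervalIntegral.integral_same, add_zero]
    nlinarith
  linarith [hzero.trans hle]

lemma rpow_kernel_mul_le {α : ℝ} (hα : α ∈ Ioo (0:ℝ) 1) {ξ τ s t : ℝ} (hξτ : ξ < τ)
    (hτs : τ < s) (hst : s ≤ t) :
    (t - τ) ^ (α - 1) * ((τ - ξ) / (t - ξ)) ^ (α - 1) ≤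
      (s - τ) ^ (α - 1) + (τ - ξ) ^ (α - 1) := by
  obtain ⟨hα0, hα1⟩ := hα
  have h1 : 0 < t - τ := by linarith
  have h2 : 0 < τ - ξ := by linarith
  have h3 : 0 < t - ξ := by linarith
  have h4 : 0 < s - τ := by linarith
  have hinv : ∀ y : ℝ, 0 < y → y ^ (α - 1) = (y⁻¹) ^ (1 - α) := by
    intro y hy
    rw [Real.inv_rpow hy.le, ← Real.rpow_neg hy.le, neg_sub]
  have hsplit : ((t - τ) * ((τ - ξ) / (t - ξ)))⁻¹ = (t - τ)⁻¹ + (τ - ξ)⁻¹ := by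
    field_simp
    ring
  rw [← Real.mul_rpow h1.le (by positivity), hinv _ (by positivity), hsplit, hinv _ h4,
    hinv _ h2]
  calc ((t - τ)⁻¹ + (τ - ξ)⁻¹) ^ (1 - α)
      ≤ ((t - τ)⁻¹) ^ (1 - α) + ((τ - ξ)⁻¹) ^ (1 - α) :=
        Real.rpow_add_le_add_rpow (by positivity) (by positivity) (by linarith) (by linarith)
    _ ≤ _ := by gcongr

lemma norm_integral_rpow_kernel_le {α : ℝ} (hα : α ∈ Ioo (0:ℝ) 1) {g : ℝ → ℝ}
    {ξ s t C : ℝ} (hC : 0 ≤ C) (hξs : ξ ≤ s) (hst : s ≤ t)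
    (hgC : ∀ τ ∈ Ioo ξ s, |g τ| ≤ C * ((τ - ξ) / (t - ξ)) ^ (α - 1)) :
    |∫ τ in ξ..s, (t - τ) ^ (α - 1) * g τ| ≤ C * (2 / α * (s - ξ) ^ α) := by
  have hint1 := intervalIntegrable_sub_rpow hα.1 s ξ s
  have hint2 : IntervalIntegrable (fun τ => (τ - ξ) ^ (α - 1)) volume ξ s := by
    simpa using (intervalIntegral.intervalIntegrable_rpow' (a := 0) (b := s - ξ)
      (r := α - 1) (by linarith [hα.1])).comp_sub_right ξ
  have hbound : ∀ᵐ τ, τ ∈ Ioc ξ s → ‖(t - τ) ^ (α - 1) * g τ‖ ≤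
      C * ((s - τ) ^ (α - 1) + (τ - ξ) ^ (α - 1)) := by
    filter_upwards [Measure.ae_ne volume s] with τ hne hτ
    have hτs : τ < s := lt_of_le_of_ne hτ.2 hne
    have hpos : 0 ≤ (t - τ) ^ (α - 1) := Real.rpow_nonneg (by linarith) _
    rw [norm_mul, Real.norm_of_nonneg hpos, Real.norm_eq_abs]
    calc (t - τ) ^ (α - 1) * |g τ|
        ≤ (t - τ) ^ (α - 1) * (C * ((τ - ξ) / (t - ξ)) ^ (α - 1)) :=
          mul_le_mul_of_nonneg_left (hgC τ ⟨hτ.1, hτs⟩) hpos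
      _ = C * ((t - τ) ^ (α - 1) * ((τ - ξ) / (t - ξ)) ^ (α - 1)) := by ring
      _ ≤ _ := mul_le_mul_of_nonneg_left (rpow_kernel_mul_le hα hτ.1 hτs hst) hC
  refine (intervalIntegral.norm_integral_le_of_norm_le hξs hbound
    ((hint1.add hint2).const_mul C)).trans_eq ?_
  have hα1 : -1 < α - 1 := by linarith [hα.1]
  rw [intervalIntegral.integral_const_mul, intervalIntegral.integral_add hint1 hint2,
    intervalIntegral.integral_comp_sub_left (fun y => y ^ (α - 1)),
    intervalIntegral.integral_comp_sub_right (fun y => y ^ (α - 1)), sub_self, sub_self,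
    integral_rpow (Or.inl hα1), sub_add_cancel, Real.zero_rpow hα.1.ne']
  ring

/-- Extends a positive lower bound on truncated integrals by a fixed step `δ`. -/
lemma truncatedVolterra_lower_bound_step {α T x₀ M X δ : ℝ} (hα : α ∈ Ioo (0:ℝ) 1)
    (hx₀ : 0 < x₀) {g : ℝ → ℝ} (hg : Continuous g) (hM : 0 ≤ M)
    (hgM : ∀ t ∈ Icc 0 T, |g t| ≤ M * |truncatedVolterra α x₀ g t t|)
    (hX : ∀ t ∈ Icc 0 T, |truncatedVolterra α x₀ g t t| ≤ X)
    (hδ : M * (2 / α * δ ^ α) ≤ 1 / 3) {ξ c : ℝ} (hξ : 0 ≤ ξ) (hc : 0 < c)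
    (hq : ∀ s t, 0 ≤ s → s ≤ ξ → s ≤ t → t ≤ T → c ≤ truncatedVolterra α x₀ g s t)
    {s t : ℝ} (hs : 0 ≤ s) (hsξ : s ≤ ξ + δ) (hst : s ≤ t) (htT : t ≤ T) :
    c / 3 ≤ truncatedVolterra α x₀ g s t := by
  set q := truncatedVolterra α x₀ g with hqdef
  have key : ∀ K, 0 ≤ K → ∀ s t, ξ ≤ s → s ≤ ξ + δ → s ≤ t → t ≤ T →
      (∀ τ ∈ Icc ξ s, |q τ τ| ≤ K * q ξ τ) → |q s t - q ξ t| ≤ K / 3 * q ξ t := by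
    intro K hK s t hξs hsδ hst htT hKx
    have hqt : 0 ≤ q ξ t := hc.le.trans (hq ξ t hξ le_rfl (hξs.trans hst) htT)
    rw [hqdef, truncatedVolterra_sub hα.1 x₀ hg]
    refine (norm_integral_rpow_kernel_le hα (C := M * K * q ξ t) (by positivity) hξs hst
      ?_).trans ?_
    · intro τ hτ
      have hτ0 : 0 < τ - ξ := sub_pos.2 hτ.1
      have hτt : τ ≤ t := hτ.2.le.trans hst
      have hmono := truncatedVolterra_mono hα hx₀ hg hξ hτ.1 hτt
        (fun r hr => hc.le.trans (hq r τ hr.1 hr.2 (hr.2.trans hτ.1.le) (hτt.trans htT)))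
      have hratio : 0 < (τ - ξ) / (t - ξ) := div_pos hτ0 (by linarith)
      have hle : q ξ τ ≤ q ξ t * ((τ - ξ) / (t - ξ)) ^ (α - 1) := by
        rw [show α - 1 = -(1 - α) by ring, Real.rpow_neg hratio.le, ← div_eq_mul_inv,
          le_div_iff₀ (Real.rpow_pos_of_pos hratio _), mul_comm]
        exact hmono
      calc |g τ| ≤ M * |q τ τ| := hgM τ ⟨hξ.trans hτ.1.le, hτt.trans htT⟩
        _ ≤ M * (K * (q ξ t * ((τ - ξ) / (t - ξ)) ^ (α - 1))) := by
            gcongr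
            exact (hKx τ ⟨hτ.1.le, hτ.2.le⟩).trans (by gcongr)
        _ = _ := by ring
    · have hpow : (s - ξ) ^ α ≤ δ ^ α :=
        Real.rpow_le_rpow (by linarith) (by linarith) hα.1.le
      have hα0 := hα.1
      calc M * K * q ξ t * (2 / α * (s - ξ) ^ α)
          ≤ M * K * q ξ t * (2 / α * δ ^ α) := by gcongr
        _ = K * q ξ t * (M * (2 / α * δ ^ α)) := by ring
        _ ≤ K * q ξ t * (1 / 3) := by gcongr
        _ = _ := by ring
  rcases le_total s ξ with hle | hξs
  · linarith [hq s t hs hle hst htT]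
  have hξT : ξ ≤ T := hξs.trans (hst.trans htT)
  have hX0 : 0 ≤ X := (abs_nonneg _).trans (hX ξ ⟨hξ, hξT⟩)
  have iter : ∀ n : ℕ, ∀ τ, ξ ≤ τ → τ ≤ ξ + δ → τ ≤ T →
      |q τ τ| ≤ (3 / 2 + X / c * (1 / 3) ^ n) * q ξ τ := by
    intro n
    induction n with
    | zero =>
      intro τ hξτ _ hτT
      have hcq := hq ξ τ hξ le_rfl hξτ hτT
      have hXq : X ≤ X / c * q ξ τ := by
        calc X = X / c * c := by field_simp
          _ ≤ _ := by gcongr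
      have := hX τ ⟨hξ.trans hξτ, hτT⟩
      rw [pow_zero]
      linarith
    | succ n ih =>
      intro τ hξτ hτδ hτT
      have hcq := hq ξ τ hξ le_rfl hξτ hτT
      have h := key _ (by positivity) τ τ hξτ hτδ le_rfl hτT
        (fun r hr => ih r hr.1 (hr.2.trans hτδ) (hr.2.trans hτT))
      have habs : |q τ τ| ≤ |q τ τ - q ξ τ| + |q ξ τ| := by
        simpa using abs_add_le (q τ τ - q ξ τ) (q ξ τ)
      rw [abs_of_pos (hc.trans_le hcq)] at habs
      calc |q τ τ| ≤ _ := habs.trans (add_le_add_left h _)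
        _ = _ := by ring
  obtain ⟨n, hn⟩ : ∃ n : ℕ, X / c * (1 / 3) ^ n < 1 / 2 := by
    have hlim := (tendsto_pow_atTop_nhds_zero_of_lt_one (r := (1 / 3 : ℝ)) (by norm_num)
      (by norm_num)).const_mul (X / c)
    rw [mul_zero] at hlim
    exact (hlim.eventually_lt_const (by norm_num)).exists
  have hfin := key 2 (by norm_num) s t hξs hsξ hst htT (fun τ hτ => by
    have hcq := hq ξ τ hξ le_rfl hτ.1 (hτ.2.trans (hst.trans htT))
    refine (iter n τ hτ.1 (hτ.2.trans hsξ) (hτ.2.trans (hst.trans htT))).trans ?_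
    have : 0 ≤ q ξ τ := hc.le.trans hcq
    gcongr
    linarith)
  have hcq := hq ξ t hξ le_rfl (hξs.trans hst) htT
  linarith [(abs_le.1 hfin).1]

lemma truncatedVolterra_diag_pos {α T x₀ M X : ℝ} (hα : α ∈ Ioo (0:ℝ) 1)
    (hx₀ : 0 < x₀) {g : ℝ → ℝ} (hg : Continuous g) (hM : 0 < M)
    (hgM : ∀ t ∈ Icc 0 T, |g t| ≤ M * |truncatedVolterra α x₀ g t t|)
    (hX : ∀ t ∈ Icc 0 T, |truncatedVolterra α x₀ g t t| ≤ X)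
    {t : ℝ} (ht : t ∈ Icc 0 T) : 0 < truncatedVolterra α x₀ g t t := by
  have hα0 := hα.1
  set δ : ℝ := (α / (6 * M)) ^ (1 / α) with hδdef
  have hδpos : 0 < δ := by positivity
  have hδ : M * (2 / α * δ ^ α) ≤ 1 / 3 := by
    rw [hδdef, ← Real.rpow_mul (by positivity), one_div_mul_cancel hα0.ne', Real.rpow_one]
    apply le_of_eq
    field_simp
    norm_num
  have hall : ∀ n : ℕ, ∃ c > 0, ∀ s t, 0 ≤ s → s ≤ n * δ → s ≤ t → t ≤ T →
      c ≤ truncatedVolterra α x₀ g s t := by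
    intro n
    induction n with
    | zero =>
      refine ⟨x₀, hx₀, fun s t hs hs' _ _ => ?_⟩
      obtain rfl : s = 0 := le_antisymm (by simpa using hs') hs
      simp [truncatedVolterra]
    | succ n ih =>
      obtain ⟨c, hc, hq⟩ := ih
      refine ⟨c / 3, by positivity, fun s t hs hs' hst htT => ?_⟩
      refine truncatedVolterra_lower_bound_step hα hx₀ hg hM.le hgM hX hδ
        (ξ := n * δ) (by positivity) hc hq hs ?_ hst htT
      push_cast at hs'
      linarith
  obtain ⟨n, hn⟩ := exists_nat_ge (t / δ)
  obtain ⟨c, hc, hq⟩ := hall n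
  exact hc.trans_le (hq t t ht.1 ((div_le_iff₀ hδpos).1 hn) le_rfl ht.2)

/-- positivity of solutions of the scalar fractional Volterra equation
`x(t) = x₀ + (1/Γ(α)) ∫₀^t (t-s)^{α-1} a(s) x(s) ds` when `x₀ > 0`. -/
theorem scalar_caputo_positivity
    (α T : ℝ) (hα : α ∈ Set.Ioo (0:ℝ) 1) (hT : 0 < T)
    (a : ℝ → ℝ) (ha : ContinuousOn a (Set.Icc 0 T))
    (x₀ : ℝ) (hx₀ : 0 < x₀)
    (x : ℝ → ℝ) (hx : ContinuousOn x (Set.Icc 0 T))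
    (heq : ∀ t ∈ Set.Icc (0:ℝ) T,
      x t = x₀ + (1 / Real.Gamma α) * ∫ s in (0:ℝ)..t, (t - s) ^ (α - 1) * (a s * x s)) :
    ∀ t ∈ Set.Icc (0:ℝ) T, 0 < x t := by
  set f : ℝ → ℝ := fun s => 1 / Real.Gamma α * (a s * x s) with hf
  have hfc : ContinuousOn f (Icc 0 T) := (ha.mul hx).const_mul _
  set g : ℝ → ℝ := IccExtend hT.le ((Icc 0 T).domRestrict f) with hgdef
  have hg : Continuous g := hfc.domRestrict.Icc_extend'
  have hgf : ∀ s ∈ Icc 0 T, g s = f s := fun s hs => by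
    rw [hgdef, IccExtend_of_mem _ _ hs, domRestrict_apply]
  have hxq : ∀ t ∈ Icc 0 T, truncatedVolterra α x₀ g t t = x t := by
    intro t ht
    rw [heq t ht, truncatedVolterra, ← intervalIntegral.integral_const_mul]
    congr 1
    refine intervalIntegral.integral_congr fun s hs => ?_
    rw [uIcc_of_le ht.1] at hs
    simp only [hgf s ⟨hs.1, hs.2.trans ht.2⟩, hf]
    ring
  obtain ⟨A, hA⟩ := isCompact_Icc.exists_bound_of_continuousOn ha
  obtain ⟨X, hX⟩ := isCompact_Icc.exists_bound_of_continuousOn hx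
  have hA0 : 0 ≤ A := (norm_nonneg _).trans (hA 0 ⟨le_rfl, hT.le⟩)
  have hΓ : 0 < Real.Gamma α := Real.Gamma_pos_of_pos hα.1
  intro t ht
  rw [← hxq t ht]
  refine truncatedVolterra_diag_pos hα hx₀ hg (M := 1 / Real.Gamma α * (A + 1)) (X := X)
    (by positivity) (fun s hs => ?_) (fun s hs => ?_) ht
  · rw [hxq s hs, hgf s hs, hf, abs_mul, abs_mul, abs_of_pos (by positivity), mul_assoc]
    have := hA s hs
    rw [Real.norm_eq_abs] at this
    gcongr
    linarith
  · rw [hxq s hs]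
    exact hX s hs
end

section
/- Let α ∈ (0,1), a < b reals, let A be a real symmetric d×d matrix, g : [a,b] → ℝ continuous, y₀ ∈ ℝ^d and z_b ∈ ℝ^d. Suppose w : [a,b] → ℝ^d is continuous and satisfies w(t) = y₀ + (1/Γ(α)) ∫_a^t (t−s)^{α−1} g(s) A w(s) ds for all t ∈ [a,b], and z : [a,b) → ℝ^d satisfies z(t) = (b−t)^{α−1}/Γ(α) · z_b + (1/Γ(α)) ∫_t^b (s−t)^{α−1} g(s) A z(s) ds for all t ∈ [a,b), with t ↦ (b−t)^{1−α} z(t) extending continuously to [a,b]. Then ⟨w(b), z_b⟩ = ⟨y₀, z₀⟩, where z₀ = (1/Γ(1−α)) ∫_a^b (τ−a)^{−α} z(τ) dτ. -/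
open MeasureTheory Set Matrix
open scoped RealInnerProductSpace

theorem setIntegral_rpow_mul_rpow {x y u v : ℝ} (hxy : x < y) (hu : 0 < u) (hv : 0 < v) :
    ∫ t in Ioo x y, (y - t) ^ (u - 1) * (t - x) ^ (v - 1) =
      (y - x) ^ (u + v - 1) * ProbabilityTheory.beta u v := by
  have h := Complex.betaIntegral_scaled v u (sub_pos.2 hxy)
  have key : ∫ t in (0 : ℝ)..(y - x), t ^ (v - 1) * (y - x - t) ^ (u - 1) =
      (y - x) ^ (u + v - 1) * ProbabilityTheory.beta u v := by
    apply Complex.ofReal_injective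
    rw [← intervalIntegral.integral_ofReal]
    have e : ((ProbabilityTheory.beta u v : ℝ) : ℂ) = Complex.betaIntegral v u := by
      rw [Complex.betaIntegral_eq_Gamma_mul_div _ _ (by simpa) (by simpa), ProbabilityTheory.beta]
      simp only [← Complex.ofReal_add, Complex.Gamma_ofReal]
      push_cast
      rw [add_comm u, mul_comm (Real.Gamma u : ℂ)]
    rw [Complex.ofReal_mul, e, Complex.ofReal_cpow (sub_pos.2 hxy).le]
    push_cast at h ⊢
    rw [add_comm (u : ℂ), ← h]
    refine intervalIntegral.integral_congr fun t ht ↦ ?_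
    rw [uIcc_of_le (sub_pos.2 hxy).le] at ht
    simp only [Complex.ofReal_cpow ht.1, Complex.ofReal_cpow (sub_nonneg.2 ht.2)]
    push_cast
    rfl
  rw [← integral_Ioc_eq_integral_Ioo, ← intervalIntegral.integral_of_le hxy.le, ← key]
  have := intervalIntegral.integral_comp_sub_right (a := x) (b := y)
    (fun t ↦ t ^ (v - 1) * (y - x - t) ^ (u - 1)) x
  rw [sub_self] at this
  rw [← this]
  congr 1 with t
  rw [mul_comm]
  congr 2
  ring

theorem integrableOn_rpow_mul_rpow {x y u v : ℝ} (hxy : x < y) (hu : 0 < u) (hv : 0 < v) :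
    IntegrableOn (fun t ↦ (y - t) ^ (u - 1) * (t - x) ^ (v - 1)) (Ioo x y) := by
  by_contra h
  have h0 := integral_undef h
  rw [setIntegral_rpow_mul_rpow hxy hu hv] at h0
  have := mul_pos (Real.rpow_pos_of_pos (sub_pos.2 hxy) (u + v - 1))
    (ProbabilityTheory.beta_pos hu hv)
  exact this.ne' h0

/-- The Abel kernel `(t - s)₊ ^ (α - 1)`. -/
noncomputable def abelKernel (α t s : ℝ) : ℝ := (max (t - s) 0) ^ (α - 1)

theorem measurable_abelKernel (α : ℝ) :
    Measurable fun p : ℝ × ℝ ↦ abelKernel α p.1 p.2 := by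
  unfold abelKernel
  fun_prop

theorem abelKernel_nonneg (α t s : ℝ) : 0 ≤ abelKernel α t s :=
  Real.rpow_nonneg (le_max_right _ _) _

theorem abelKernel_of_lt {α t s : ℝ} (h : s < t) : abelKernel α t s = (t - s) ^ (α - 1) := by
  rw [abelKernel, max_eq_left (sub_pos.2 h).le]

theorem abelKernel_of_le {α t s : ℝ} (hα : α ≠ 1) (h : t ≤ s) : abelKernel α t s = 0 := by
  rw [abelKernel, max_eq_right (sub_nonpos.2 h), Real.zero_rpow (sub_ne_zero.2 hα)]

section
variable {E : Type*} [NormedAddCommGroup E] [NormedSpace ℝ E]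

theorem abelKernel_smul_left {α : ℝ} (hα : α ≠ 1) (t : ℝ) (f : ℝ → E) :
    (fun s ↦ abelKernel α t s • f s) = (Iio t).indicator fun s ↦ (t - s) ^ (α - 1) • f s := by
  ext s
  by_cases h : s < t
  · simp [h, abelKernel_of_lt h]
  · simp [h, abelKernel_of_le hα (not_lt.1 h)]

theorem abelKernel_smul_right {α : ℝ} (hα : α ≠ 1) (s : ℝ) (f : ℝ → E) :
    (fun t ↦ abelKernel α t s • f t) = (Ioi s).indicator fun t ↦ (t - s) ^ (α - 1) • f t := by
  ext t
  by_cases h : s < t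
  · simp [h, abelKernel_of_lt h]
  · simp [h, abelKernel_of_le hα (not_lt.1 h)]

theorem setIntegral_abelKernel_left {α a b t : ℝ} (hα : α ≠ 1) (ht : t ≤ b) (f : ℝ → E) :
    ∫ s in Ioo a b, abelKernel α t s • f s = ∫ s in Ioo a t, (t - s) ^ (α - 1) • f s := by
  rw [abelKernel_smul_left hα, setIntegral_indicator measurableSet_Iio, Ioo_inter_Iio,
    min_eq_right ht]

theorem setIntegral_abelKernel_right {α a b s : ℝ} (hα : α ≠ 1) (hs : a ≤ s) (f : ℝ → E) :
    ∫ t in Ioo a b, abelKernel α t s • f t = ∫ t in Ioo s b, (t - s) ^ (α - 1) • f t := by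
  rw [abelKernel_smul_right hα, setIntegral_indicator measurableSet_Ioi, inter_comm,
    Ioi_inter_Ioo, max_eq_left hs]

end

theorem integrableOn_abelKernel_left {α a b t : ℝ} (h0 : 0 < α) (h1 : α < 1)
    (ht : t ∈ Ioo a b) :
    IntegrableOn (fun s ↦ abelKernel α t s * (s - a) ^ (-α)) (Ioo a b) := by
  have h := abelKernel_smul_left h1.ne t fun s ↦ (s - a) ^ (-α)
  simp only [smul_eq_mul] at h
  rw [h, integrableOn_indicator_iff measurableSet_Iio, inter_comm, Ioo_inter_Iio,
    min_eq_right ht.2.le]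
  have := integrableOn_rpow_mul_rpow ht.1 h0 (sub_pos.2 h1)
  rwa [show 1 - α - 1 = -α by ring] at this

theorem integrableOn_abelKernel_right {α a b s : ℝ} (h0 : 0 < α) (h1 : α < 1)
    (hs : s ∈ Ioo a b) :
    IntegrableOn (fun t ↦ abelKernel α t s * (b - t) ^ (α - 1)) (Ioo a b) := by
  have h := abelKernel_smul_right h1.ne s fun t ↦ (b - t) ^ (α - 1)
  simp only [smul_eq_mul] at h
  rw [h, integrableOn_indicator_iff measurableSet_Ioi,
    Ioi_inter_Ioo, max_eq_left hs.1.le]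
  simpa only [mul_comm] using integrableOn_rpow_mul_rpow hs.2 h0 h0

theorem setIntegral_abelKernel_mul_rpow {α a b t : ℝ} (h0 : 0 < α) (h1 : α < 1)
    (ht : t ∈ Ioc a b) :
    ∫ s in Ioo a t, (t - s) ^ (α - 1) * (s - a) ^ (-α) =
      Real.Gamma α * Real.Gamma (1 - α) := by
  have := setIntegral_rpow_mul_rpow ht.1 h0 (sub_pos.2 h1)
  rw [show 1 - α - 1 = -α by ring] at this
  rw [this]
  simp [ProbabilityTheory.beta]

theorem integrableOn_rpow_sub {α a b : ℝ} (h0 : 0 < α) (hab : a < b) :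
    IntegrableOn (fun t ↦ (b - t) ^ (α - 1)) (Ioo a b) := by
  simpa using integrableOn_rpow_mul_rpow hab h0 one_pos

theorem integrable_abelKernel_mul_rpow {α a b : ℝ} (h0 : 0 < α) (h1 : α < 1) :
    Integrable (fun p : ℝ × ℝ ↦ abelKernel α p.1 p.2 * (p.2 - a) ^ (-α) * (b - p.1) ^ (α - 1))
      ((volume.restrict (Ioo a b)).prod (volume.restrict (Ioo a b))) := by
  have hm : Measurable
      (fun p : ℝ × ℝ ↦ abelKernel α p.1 p.2 * (p.2 - a) ^ (-α) * (b - p.1) ^ (α - 1)) := by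
    have := measurable_abelKernel α
    fun_prop
  rw [integrable_prod_iff hm.aestronglyMeasurable]
  constructor
  · filter_upwards [ae_restrict_mem measurableSet_Ioo] with t ht
    exact (integrableOn_abelKernel_left h0 h1 ht).mul_const _
  · rcases le_or_gt b a with hba | hab
    · simp [Ioo_eq_empty hba.not_gt]
    refine ((integrableOn_rpow_sub h0 hab).const_mul
      (Real.Gamma α * Real.Gamma (1 - α))).congr ?_
    filter_upwards [ae_restrict_mem measurableSet_Ioo] with t ht
    rw [← setIntegral_abelKernel_mul_rpow h0 h1 (Ioo_subset_Ioc_self ht), ← integral_mul_const]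
    have := setIntegral_abelKernel_left (a := a) h1.ne ht.2.le
      fun s ↦ (s - a) ^ (-α) * (b - t) ^ (α - 1)
    simp only [smul_eq_mul, ← mul_assoc] at this
    rw [← this]
    refine setIntegral_congr_fun measurableSet_Ioo fun s hs ↦ ?_
    have := abelKernel_nonneg α t s
    have := Real.rpow_nonneg (sub_pos.2 hs.1).le (-α)
    have := Real.rpow_nonneg (sub_pos.2 ht.2).le (α - 1)
    rw [Real.norm_of_nonneg (by positivity)]

theorem setIntegral_inner_abel_comm {E : Type*} [NormedAddCommGroup E] [InnerProductSpace ℝ E]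
    [CompleteSpace E] {α a b C D : ℝ} (h0 : 0 < α) (h1 : α < 1) {F G : ℝ → E}
    (hF : AEStronglyMeasurable F (volume.restrict (Ioo a b)))
    (hG : AEStronglyMeasurable G (volume.restrict (Ioo a b)))
    (hFC : ∀ s ∈ Ioo a b, ‖F s‖ ≤ C * (s - a) ^ (-α))
    (hGD : ∀ t ∈ Ioo a b, ‖G t‖ ≤ D * (b - t) ^ (α - 1)) :
    ∫ s in Ioo a b, ⟪F s, ∫ t in Ioo s b, (t - s) ^ (α - 1) • G t⟫ =
      ∫ t in Ioo a b, ⟪∫ s in Ioo a t, (t - s) ^ (α - 1) • F s, G t⟫ := by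
  have hk := measurable_abelKernel α
  have hint : Integrable (fun p : ℝ × ℝ ↦ abelKernel α p.1 p.2 * ⟪F p.2, G p.1⟫)
      ((volume.restrict (Ioo a b)).prod (volume.restrict (Ioo a b))) := by
    refine ((integrable_abelKernel_mul_rpow h0 h1).const_mul (C * D)).mono'
      (hk.aestronglyMeasurable.mul (hF.comp_snd.inner hG.comp_fst)) ?_
    rw [Measure.prod_restrict]
    filter_upwards [ae_restrict_mem (measurableSet_Ioo.prod measurableSet_Ioo)] with p hp
    have hk0 := abelKernel_nonneg α p.1 p.2
    rw [norm_mul, Real.norm_of_nonneg hk0]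
    have := hFC _ hp.2
    calc abelKernel α p.1 p.2 * ‖⟪F p.2, G p.1⟫‖
        ≤ abelKernel α p.1 p.2 * (‖F p.2‖ * ‖G p.1‖) := by gcongr; exact norm_inner_le_norm _ _
      _ ≤ abelKernel α p.1 p.2 * ((C * (p.2 - a) ^ (-α)) * (D * (b - p.1) ^ (α - 1))) := by
        gcongr
        · exact (norm_nonneg _).trans this
        · exact hGD _ hp.1
      _ = _ := by ring
  have hswap := integral_integral_swap (f := fun t s ↦ abelKernel α t s * ⟪F s, G t⟫) hint
  have hl : ∀ s ∈ Ioo a b, ⟪F s, ∫ t in Ioo s b, (t - s) ^ (α - 1) • G t⟫ =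
      ∫ t in Ioo a b, abelKernel α t s * ⟪F s, G t⟫ := by
    intro s hs
    rw [← setIntegral_abelKernel_right h1.ne hs.1.le, ← integral_inner]
    · simp only [real_inner_smul_right]
    · refine ((integrableOn_abelKernel_right h0 h1 hs).const_mul D).mono'
        ((hk.comp measurable_prodMk_right).aestronglyMeasurable.smul hG) ?_
      filter_upwards [ae_restrict_mem measurableSet_Ioo] with t ht
      have hk0 := abelKernel_nonneg α t s
      rw [norm_smul, Real.norm_of_nonneg hk0, mul_left_comm]
      gcongr
      exact hGD t ht
  have hr : ∀ t ∈ Ioo a b, ⟪∫ s in Ioo a t, (t - s) ^ (α - 1) • F s, G t⟫ =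
      ∫ s in Ioo a b, abelKernel α t s * ⟪F s, G t⟫ := by
    intro t ht
    rw [← setIntegral_abelKernel_left h1.ne ht.2.le, real_inner_comm, ← integral_inner]
    · simp only [real_inner_smul_right, real_inner_comm]
    · refine ((integrableOn_abelKernel_left h0 h1 ht).const_mul C).mono'
        ((hk.comp measurable_prodMk_left).aestronglyMeasurable.smul hF) ?_
      filter_upwards [ae_restrict_mem measurableSet_Ioo] with s hs
      have hk0 := abelKernel_nonneg α t s
      rw [norm_smul, Real.norm_of_nonneg hk0, mul_left_comm]
      gcongr
      exact hFC s hs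
  rw [setIntegral_congr_fun measurableSet_Ioo hl, setIntegral_congr_fun measurableSet_Ioo hr,
    hswap]

theorem integrableOn_Ioo_smul_of_continuousOn {E : Type*} [NormedAddCommGroup E]
    [NormedSpace ℝ E] {a b : ℝ} {p : ℝ → ℝ} {h : ℝ → E}
    (hp : IntegrableOn p (Ioo a b)) (hh : ContinuousOn h (Icc a b)) :
    IntegrableOn (fun t ↦ p t • h t) (Ioo a b) := by
  rw [← integrableOn_Icc_iff_integrableOn_Ioo] at hp ⊢
  exact hp.smul_continuousOn hh isCompact_Icc

/-- duality identity `⟨w(b), z_b⟩ = ⟨y₀, z₀⟩` between the solution `w` of the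
Caputo problem `{}_a^C D_t^α w = A g(t) w`, `w(a) = y₀`, and the solution `z` of the adjoint
right Riemann–Liouville problem with terminal datum `z_b`, where
`z₀ = (1/Γ(1-α)) ∫_a^b (τ-a)^{-α} z(τ) dτ`. -/
theorem caputo_adjoint_duality
    (d : ℕ) (α a b : ℝ) (hα : α ∈ Set.Ioo (0:ℝ) 1) (hab : a < b)
    (A : Matrix (Fin d) (Fin d) ℝ) (hA : A.IsSymm)
    (g : ℝ → ℝ) (hg : ContinuousOn g (Set.Icc a b))
    (y₀ zb : EuclideanSpace ℝ (Fin d))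
    (w : ℝ → EuclideanSpace ℝ (Fin d)) (hwc : ContinuousOn w (Set.Icc a b))
    (hw : ∀ t ∈ Set.Icc a b,
      w t = y₀ + (1 / Real.Gamma α) •
        ∫ s in a..t, (t - s) ^ (α - 1) • (g s • Matrix.toEuclideanLin A (w s)))
    (z : ℝ → EuclideanSpace ℝ (Fin d))
    (hz : ∀ t ∈ Set.Ico a b,
      z t = ((b - t) ^ (α - 1) / Real.Gamma α) • zb +
        (1 / Real.Gamma α) •
          ∫ s in t..b, (s - t) ^ (α - 1) • (g s • Matrix.toEuclideanLin A (z s)))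
    (ze : ℝ → EuclideanSpace ℝ (Fin d)) (hzec : ContinuousOn ze (Set.Icc a b))
    (hext : ∀ t ∈ Set.Ico a b, ze t = (b - t) ^ (1 - α) • z t) :
    ⟪w b, zb⟫ = ⟪y₀, (1 / Real.Gamma (1 - α)) • ∫ τ in a..b, (τ - a) ^ (-α) • z τ⟫ := by
  obtain ⟨h0, h1⟩ := hα
  have hΓ : 0 < Real.Gamma α := Real.Gamma_pos_of_pos h0
  have hΓ' : 0 < Real.Gamma (1 - α) := Real.Gamma_pos_of_pos (sub_pos.2 h1)
  have hsymm : ∀ x y, ⟪Matrix.toEuclideanLin A x, y⟫ = ⟪x, Matrix.toEuclideanLin A y⟫ :=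
    Matrix.isSymmetric_toEuclideanLin_iff.2 (Matrix.isHermitian_iff_isSymm.2 hA)
  have hL : Continuous (Matrix.toEuclideanLin A) := LinearMap.continuous_of_finiteDimensional _
  set L := Matrix.toEuclideanLin A
  have hwI : ∀ t ∈ Ioc a b, w t = y₀ + (1 / Real.Gamma α) •
      ∫ s in Ioo a t, (t - s) ^ (α - 1) • (g s • L (w s)) := fun t ht ↦ by
    rw [hw t (Ioc_subset_Icc_self ht), intervalIntegral.integral_of_le ht.1.le,
      integral_Ioc_eq_integral_Ioo]
  have hzI : ∀ t ∈ Ioo a b, z t = ((b - t) ^ (α - 1) / Real.Gamma α) • zb +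
      (1 / Real.Gamma α) • ∫ s in Ioo t b, (s - t) ^ (α - 1) • (g s • L (z s)) := fun t ht ↦ by
    rw [hz t (Ioo_subset_Ico_self ht), intervalIntegral.integral_of_le ht.2.le,
      integral_Ioc_eq_integral_Ioo]
  rw [intervalIntegral.integral_of_le hab.le, integral_Ioc_eq_integral_Ioo]
  set F := fun s ↦ g s • L (w s)
  set G := fun s ↦ g s • L (z s)
  have hFcont : ContinuousOn F (Icc a b) := hg.smul (hL.comp_continuousOn hwc)
  have hzze : ∀ t ∈ Ioo a b, (b - t) ^ (α - 1) • ze t = z t := fun t ht ↦ by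
    rw [hext t (Ioo_subset_Ico_self ht), smul_smul, ← Real.rpow_add (sub_pos.2 ht.2)]
    simp
  have hGe : ContinuousOn (fun t ↦ g t • L (ze t)) (Icc a b) :=
    hg.smul (hL.comp_continuousOn hzec)
  have hGeq : ∀ t ∈ Ioo a b, (b - t) ^ (α - 1) • (g t • L (ze t)) = G t := fun t ht ↦ by
    simp only [G, ← hzze t ht, map_smul, smul_comm (g t)]
  have hGint : IntegrableOn G (Ioo a b) :=
    (integrableOn_Ioo_smul_of_continuousOn (integrableOn_rpow_sub h0 hab) hGe).congr_fun hGeq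
      measurableSet_Ioo
  obtain ⟨D, hD⟩ := isCompact_Icc.exists_bound_of_continuousOn hGe
  have hGD : ∀ t ∈ Ioo a b, ‖G t‖ ≤ D * (b - t) ^ (α - 1) := fun t ht ↦ by
    have hb := Real.rpow_nonneg (sub_pos.2 ht.2).le (α - 1)
    rw [← hGeq t ht, norm_smul, Real.norm_of_nonneg hb, mul_comm]
    gcongr
    exact hD t (Ioo_subset_Icc_self ht)
  obtain ⟨C, hC⟩ := isCompact_Icc.exists_bound_of_continuousOn
    (f := fun s ↦ (s - a) ^ α • F s)
    (((continuousOn_id.sub continuousOn_const).rpow_const fun _ _ ↦ Or.inr h0.le).smul hFcont)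
  have hFC : ∀ s ∈ Ioo a b, ‖F s‖ ≤ C * (s - a) ^ (-α) := fun s hs ↦ by
    have hp := Real.rpow_pos_of_pos (sub_pos.2 hs.1) α
    have := hC s (Ioo_subset_Icc_self hs)
    rw [norm_smul, Real.norm_of_nonneg hp.le] at this
    rw [Real.rpow_neg (sub_pos.2 hs.1).le, ← div_eq_mul_inv, le_div_iff₀ hp, mul_comm]
    exact this
  have hFmeas : AEStronglyMeasurable F (volume.restrict (Ioo a b)) :=
    (hFcont.mono Ioo_subset_Icc_self).aestronglyMeasurable measurableSet_Ioo
  have hwG : IntegrableOn (fun t ↦ ⟪w t, G t⟫) (Ioo a b) := by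
    refine (integrableOn_Ioo_smul_of_continuousOn (integrableOn_rpow_sub h0 hab)
      (hwc.inner hGe)).congr_fun (fun t ht ↦ ?_) measurableSet_Ioo
    simp only [← hGeq t ht, real_inner_smul_right, smul_eq_mul]
  have hFzb : IntegrableOn (fun s ↦ (b - s) ^ (α - 1) • F s) (Ioo a b) :=
    integrableOn_Ioo_smul_of_continuousOn (integrableOn_rpow_sub h0 hab) hFcont
  have hbeta : IntegrableOn (fun s ↦ (b - s) ^ (α - 1) * (s - a) ^ (-α)) (Ioo a b) := by
    have := integrableOn_rpow_mul_rpow hab h0 (sub_pos.2 h1)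
    rwa [show 1 - α - 1 = -α by ring] at this
  have hzint : IntegrableOn (fun s ↦ (s - a) ^ (-α) • z s) (Ioo a b) := by
    refine (integrableOn_Ioo_smul_of_continuousOn hbeta hzec).congr_fun (fun t ht ↦ ?_)
      measurableSet_Ioo
    simp only [← hzze t ht, smul_smul, mul_comm]
  have hmain := setIntegral_inner_abel_comm h0 h1 hFmeas hGint.aestronglyMeasurable hFC hGD
  have hl : ∫ s in Ioo a b, ⟪F s, ∫ t in Ioo s b, (t - s) ^ (α - 1) • G t⟫ =
      Real.Gamma α * (∫ t in Ioo a b, ⟪w t, G t⟫) -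
        ⟪zb, ∫ s in Ioo a b, (b - s) ^ (α - 1) • F s⟫ := by
    rw [← integral_inner hFzb, ← integral_const_mul, ← integral_sub (hwG.const_mul _)
      (hFzb.const_inner zb)]
    refine setIntegral_congr_fun measurableSet_Ioo fun s hs ↦ ?_
    have e : ⟪w s, G s⟫ = ⟪F s, z s⟫ := by
      simp only [F, G, real_inner_smul_left, real_inner_smul_right, hsymm]
    simp only [e]
    rw [hzI s hs, inner_add_right, real_inner_smul_right, real_inner_smul_right,
      real_inner_smul_right, real_inner_comm zb]
    field_simp
    ring
  have hr : ∫ t in Ioo a b, ⟪∫ s in Ioo a t, (t - s) ^ (α - 1) • F s, G t⟫ =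
      Real.Gamma α * ((∫ t in Ioo a b, ⟪w t, G t⟫) - ⟪y₀, ∫ t in Ioo a b, G t⟫) := by
    rw [← integral_inner hGint, ← integral_sub hwG (hGint.const_inner y₀), ← integral_const_mul]
    refine setIntegral_congr_fun measurableSet_Ioo fun t ht ↦ ?_
    rw [← inner_sub_left, hwI t (Ioo_subset_Ioc_self ht), add_sub_cancel_left,
      real_inner_smul_left]
    field_simp
    rfl
  have hdata : ∫ s in Ioo a b, ⟪(s - a) ^ (-α) • y₀, ∫ t in Ioo s b, (t - s) ^ (α - 1) • G t⟫ =
      Real.Gamma α * Real.Gamma (1 - α) * ⟪y₀, ∫ t in Ioo a b, G t⟫ := by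
    rw [setIntegral_inner_abel_comm (F := fun s ↦ (s - a) ^ (-α) • y₀) (C := ‖y₀‖) h0 h1
      (((measurable_id.sub_const a).pow_const (-α)).smul_const y₀).aestronglyMeasurable
      hGint.aestronglyMeasurable (fun s hs ↦ ?_) hGD, ← integral_inner hGint,
      ← integral_const_mul]
    · refine setIntegral_congr_fun measurableSet_Ioo fun t ht ↦ ?_
      simp only [smul_smul]
      rw [integral_smul_const, setIntegral_abelKernel_mul_rpow h0 h1 (Ioo_subset_Ioc_self ht),
        real_inner_smul_left]
    · rw [norm_smul, Real.norm_of_nonneg (Real.rpow_nonneg (sub_pos.2 hs.1).le _), mul_comm]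
  have hz0 : ∫ s in Ioo a b, ⟪(s - a) ^ (-α) • y₀, ∫ t in Ioo s b, (t - s) ^ (α - 1) • G t⟫ =
      Real.Gamma α * ⟪y₀, ∫ s in Ioo a b, (s - a) ^ (-α) • z s⟫ -
        Real.Gamma α * Real.Gamma (1 - α) * ⟪y₀, zb⟫ := by
    rw [← setIntegral_abelKernel_mul_rpow h0 h1 (right_mem_Ioc.2 hab), ← integral_inner hzint,
      ← integral_const_mul, ← integral_mul_const,
      ← integral_sub ((hzint.const_inner y₀).const_mul _) (hbeta.mul_const _)]
    refine setIntegral_congr_fun measurableSet_Ioo fun s hs ↦ ?_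
    rw [hzI s hs]
    simp only [inner_add_right, real_inner_smul_right, real_inner_smul_left]
    field_simp
    ring
  have hkey : ⟪zb, ∫ s in Ioo a b, (b - s) ^ (α - 1) • F s⟫ =
      Real.Gamma α * ⟪y₀, ∫ t in Ioo a b, G t⟫ := by
    linarith
  rw [hwI b (right_mem_Ioc.2 hab), inner_add_left, real_inner_smul_left, real_inner_smul_right,
    real_inner_comm zb (∫ s in Ioo a b, _), hkey]
  have hz0' := hdata.symm.trans hz0
  field_simp
  have : Real.Gamma α * ((⟪y₀, zb⟫ + ⟪y₀, ∫ t in Ioo a b, G t⟫) * Real.Gamma (1 - α)) =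
      Real.Gamma α * ⟪y₀, ∫ s in Ioo a b, (s - a) ^ (-α) • z s⟫ := by
    linarith
  exact mul_left_cancel₀ hΓ.ne' this
end

section
/- Let α ∈ (0,1), 0 < T_v < T, K ≥ 0, and let z : (0,T_v] → ℝ^d be differentiable with ‖s^{1−α} z'(s)‖ ≤ K for all s ∈ (0,T_v]. Then for every t ∈ (T_v, T], the function h(t) = (1/Γ(1−α)) ∫₀^{T_v} z'(s) (t−s)^{−α} ds satisfies ‖h(t)‖ ≤ K·Γ(α). -/
open MeasureTheory Set

/-- The Beta integral rescaled to `[0, t]`, for exponents summing to `-1`. -/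
theorem integral_rpow_mul_sub_rpow_neg {α t : ℝ} (hα : α ∈ Ioo (0 : ℝ) 1) (ht : 0 < t) :
    ∫ s in (0 : ℝ)..t, s ^ (α - 1) * (t - s) ^ (-α) = Real.Gamma α * Real.Gamma (1 - α) := by
  have hre : 0 < ((1 - α : ℝ) : ℂ).re := by simpa using hα.2
  have hscaled := Complex.betaIntegral_scaled (α : ℂ) ((1 - α : ℝ) : ℂ) ht
  rw [Complex.betaIntegral_eq_Gamma_mul_div _ _ (by simpa using hα.1) hre] at hscaled
  have hsum : (α : ℂ) + ((1 - α : ℝ) : ℂ) = 1 := by push_cast; ring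
  rw [hsum, sub_self, Complex.cpow_zero, one_mul, Complex.Gamma_one, div_one,
    Complex.Gamma_ofReal, Complex.Gamma_ofReal] at hscaled
  apply Complex.ofReal_injective
  rw [← intervalIntegral.integral_ofReal, Complex.ofReal_mul, ← hscaled]
  refine intervalIntegral.integral_congr fun s hs => ?_
  rw [uIcc_of_le ht.le] at hs
  simp only [Complex.ofReal_mul, Complex.ofReal_cpow hs.1,
    Complex.ofReal_cpow (sub_nonneg.2 hs.2)]
  push_cast
  ring_nf

theorem intervalIntegrable_rpow_mul_sub_rpow_neg {α t : ℝ} (hα : α ∈ Ioo (0 : ℝ) 1)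
    (ht : 0 < t) :
    IntervalIntegrable (fun s : ℝ => s ^ (α - 1) * (t - s) ^ (-α)) volume 0 t := by
  apply intervalIntegral.intervalIntegrable_of_integral_ne_zero
  rw [integral_rpow_mul_sub_rpow_neg hα ht]
  exact (mul_pos (Real.Gamma_pos_of_pos hα.1) (Real.Gamma_pos_of_pos (sub_pos.2 hα.2))).ne'

/-- bound `‖h(t)‖ ≤ K·Γ(α)` for the memory term
`h(t) = (1/Γ(1-α)) ∫₀^{T_v} z'(s) (t-s)^{-α} ds` of the Caputo derivative, when
`‖s^{1-α} z'(s)‖ ≤ K` on `(0,T_v]`. -/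
theorem memory_term_bound
    (d : ℕ) (α Tv T K : ℝ) (hα : α ∈ Set.Ioo (0:ℝ) 1)
    (hTv : 0 < Tv) (hTvT : Tv < T) (hK : 0 ≤ K)
    (z z' : ℝ → EuclideanSpace ℝ (Fin d))
    (hz : ∀ s ∈ Set.Ioc (0:ℝ) Tv, HasDerivAt z (z' s) s)
    (hbound : ∀ s ∈ Set.Ioc (0:ℝ) Tv, ‖s ^ (1 - α) • z' s‖ ≤ K) :
    ∀ t ∈ Set.Ioc Tv T,
      ‖(1 / Real.Gamma (1 - α)) • ∫ s in (0:ℝ)..Tv, (t - s) ^ (-α) • z' s‖ ≤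
        K * Real.Gamma α := by
  intro t ht
  have ht0 : 0 < t := hTv.trans ht.1
  have hΓ : 0 < Real.Gamma (1 - α) := Real.Gamma_pos_of_pos (sub_pos.2 hα.2)
  have hint := intervalIntegrable_rpow_mul_sub_rpow_neg hα ht0
  have hpoint : ∀ s ∈ Ioc (0 : ℝ) Tv,
      ‖(t - s) ^ (-α) • z' s‖ ≤ K * (s ^ (α - 1) * (t - s) ^ (-α)) := by
    intro s hs
    have hts : 0 ≤ (t - s) ^ (-α) := Real.rpow_nonneg (by linarith [hs.2, ht.1]) _
    have hz' : ‖z' s‖ ≤ K * s ^ (α - 1) := by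
      have h := hbound s hs
      rw [norm_smul, Real.norm_of_nonneg (Real.rpow_nonneg hs.1.le _), mul_comm] at h
      rwa [← neg_sub, Real.rpow_neg hs.1.le, ← div_eq_mul_inv,
        le_div_iff₀ (Real.rpow_pos_of_pos hs.1 _)]
    rw [norm_smul, Real.norm_of_nonneg hts, ← mul_assoc, mul_comm]
    exact mul_le_mul_of_nonneg_right hz' hts
  have hmono : ∫ s in (0 : ℝ)..Tv, s ^ (α - 1) * (t - s) ^ (-α) ≤
      ∫ s in (0 : ℝ)..t, s ^ (α - 1) * (t - s) ^ (-α) := by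
    refine intervalIntegral.integral_mono_interval le_rfl hTv.le ht.1.le ?_ hint
    filter_upwards [ae_restrict_mem measurableSet_Ioc] with s hs
    exact mul_nonneg (Real.rpow_nonneg hs.1.le _) (Real.rpow_nonneg (sub_nonneg.2 hs.2) _)
  have hnorm : ‖∫ s in (0 : ℝ)..Tv, (t - s) ^ (-α) • z' s‖ ≤
      K * (Real.Gamma α * Real.Gamma (1 - α)) := by
    calc _ ≤ ∫ s in (0 : ℝ)..Tv, K * (s ^ (α - 1) * (t - s) ^ (-α)) := by
          refine intervalIntegral.norm_integral_le_of_norm_le hTv.le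
            (Filter.Eventually.of_forall hpoint) ((hint.mono_set ?_).const_mul K)
          rw [uIcc_of_le hTv.le, uIcc_of_le ht0.le]
          exact Icc_subset_Icc_right ht.1.le
      _ ≤ _ := by
          rw [intervalIntegral.integral_const_mul, ← integral_rpow_mul_sub_rpow_neg hα ht0]
          exact mul_le_mul_of_nonneg_left hmono hK
  rw [norm_smul, Real.norm_of_nonneg (one_div_pos.2 hΓ).le, one_div_mul_eq_div,
    div_le_iff₀ hΓ, mul_assoc]
  exact hnorm
end

section
/- Let α ∈ (0,1) and a < b reals. Let g : [a,b] → ℝ be continuously differentiable, and let f : [a,b) → ℝ be continuous and integrable on [a,b] such that the function φ(t) = (1/Γ(1−α)) ∫_t^b f(τ) (τ−t)^{−α} dτ is well-defined, extends continuously to [a,b], and is differentiable on (a,b) with derivative φ' such that ψ := −φ' is integrable on [a,b]. Then ∫_a^b f(t) · [ (1/Γ(1−α)) ∫_a^t g'(s) (t−s)^{−α} ds ] dt = φ(b) g(b) − φ(a) g(a) + ∫_a^b ψ(t) g(t) dt. -/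
open MeasureTheory Set

/-- Exchanging the order of integration against the weakly singular kernel `(t - s) ^ (-α)`
on the triangle `a ≤ s ≤ t ≤ b`. -/
theorem integral_mul_integral_rpow_swap {α a b : ℝ} (hα : α < 1) (hab : a ≤ b) {f h : ℝ → ℝ}
    (hf : IntervalIntegrable f volume a b) (hh : ContinuousOn h (Icc a b)) :
    ∫ t in a..b, f t * ∫ s in a..t, h s * (t - s) ^ (-α) =
      ∫ s in a..b, h s * ∫ t in s..b, f t * (t - s) ^ (-α) := by
  set F : ℝ → ℝ := (Ioc a b).indicator f with hF
  set H : ℝ → ℝ := (Ioo a b).indicator h with hH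
  set k : ℝ → ℝ := (Ioc 0 (b - a)).indicator (fun x => x ^ (-α)) with hk
  have hFint : Integrable F :=
    ((intervalIntegrable_iff_integrableOn_Ioc_of_le hab).1 hf).integrable_indicator
      measurableSet_Ioc
  have hkint : Integrable k :=
    ((intervalIntegrable_iff_integrableOn_Ioc_of_le (sub_nonneg.2 hab)).1
      (intervalIntegral.intervalIntegrable_rpow' (by linarith))).integrable_indicator
        measurableSet_Ioc
  have hHmeas : AEStronglyMeasurable H :=
    (aestronglyMeasurable_indicator_iff measurableSet_Ioo).2
      ((hh.mono Ioo_subset_Icc_self).aestronglyMeasurable measurableSet_Ioo)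
  obtain ⟨C, hC⟩ := isCompact_Icc.exists_bound_of_continuousOn hh
  have hHbdd : ∀ s, ‖H s‖ ≤ max C 0 := fun s => by
    by_cases hs : s ∈ Ioo a b
    · rw [hH, indicator_of_mem hs]
      exact (hC s (Ioo_subset_Icc_self hs)).trans (le_max_left _ _)
    · simp [hH, indicator_of_notMem hs]
  have hint : Integrable (Function.uncurry fun s t => H s * (F t * k (t - s)))
      (volume.prod volume) := by
    refine Integrable.bdd_mul (f := fun p : ℝ × ℝ => H p.1)
      (g := fun p : ℝ × ℝ => F p.2 * k (p.2 - p.1)) (c := max C 0) ?_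
      hHmeas.comp_fst (Filter.Eventually.of_forall fun p => hHbdd p.1)
    simpa using hFint.convolution_integrand (ContinuousLinearMap.mul ℝ ℝ) hkint.comp_neg
  have inner_left : ∀ t, ∫ s, H s * (F t * k (t - s)) =
      (Ioc a b).indicator (fun t => f t * ∫ s in a..t, h s * (t - s) ^ (-α)) t := fun t => by
    by_cases ht : t ∈ Ioc a b
    · rw [indicator_of_mem ht, intervalIntegral.integral_of_le ht.1.le,
        integral_Ioc_eq_integral_Ioo, ← integral_const_mul, ← integral_indicator measurableSet_Ioo]
      congr 1 with s
      obtain ⟨hat, htb⟩ := ht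
      simp only [hH, hF, hk, indicator_apply, mem_Ioo, mem_Ioc]
      split_ifs <;> first | ring1 | grind
    · simp [hF, indicator_of_notMem ht]
  have inner_right : ∀ s, ∫ t, H s * (F t * k (t - s)) =
      (Ioo a b).indicator (fun s => h s * ∫ t in s..b, f t * (t - s) ^ (-α)) s := fun s => by
    by_cases hs : s ∈ Ioo a b
    · rw [indicator_of_mem hs, intervalIntegral.integral_of_le hs.2.le,
        ← integral_const_mul, ← integral_indicator measurableSet_Ioc]
      congr 1 with t
      obtain ⟨has, hsb⟩ := hs
      simp only [hH, hF, hk, indicator_apply, mem_Ioo, mem_Ioc]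
      split_ifs <;> first | ring1 | grind
    · simp [hH, indicator_of_notMem hs]
  have swap := integral_integral_swap hint
  simp_rw [inner_left, inner_right] at swap
  rw [integral_indicator measurableSet_Ioc, integral_indicator measurableSet_Ioo,
    ← integral_Ioc_eq_integral_Ioo] at swap
  rw [intervalIntegral.integral_of_le hab, intervalIntegral.integral_of_le hab, swap]

/-- fractional integration by parts
`∫_a^b f · {}_a^C D_t^α g dt = ({}_t I_b^{1-α} f · g)|_a^b + ∫_a^b ({}_t D_b^α f) · g dt`,
where `φ = {}_t I_b^{1-α} f` and `ψ = -φ' = {}_t D_b^α f`. -/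
theorem fractional_integration_by_parts
    (α a b : ℝ) (hα : α ∈ Set.Ioo (0:ℝ) 1) (hab : a < b)
    (g g' : ℝ → ℝ)
    (hg : ∀ t ∈ Set.Icc a b, HasDerivWithinAt g (g' t) (Set.Icc a b) t)
    (hg' : ContinuousOn g' (Set.Icc a b))
    (f : ℝ → ℝ) (hf : ContinuousOn f (Set.Ico a b))
    (hfint : IntervalIntegrable f volume a b)
    (φ ψ : ℝ → ℝ)
    (hφ : ∀ t ∈ Set.Ico a b,
      φ t = (1 / Real.Gamma (1 - α)) * ∫ τ in t..b, f τ * (τ - t) ^ (-α))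
    (hφc : ContinuousOn φ (Set.Icc a b))
    (hφd : ∀ t ∈ Set.Ioo a b, HasDerivAt φ (-(ψ t)) t)
    (hψint : IntervalIntegrable ψ volume a b) :
    (∫ t in a..b, f t * ((1 / Real.Gamma (1 - α)) * ∫ s in a..t, g' s * (t - s) ^ (-α))) =
      φ b * g b - φ a * g a + ∫ t in a..b, ψ t * g t := by
  have hcaputo : (∫ t in a..b, f t * ((1 / Real.Gamma (1 - α)) *
      ∫ s in a..t, g' s * (t - s) ^ (-α))) = ∫ s in a..b, φ s * g' s := by
    simp_rw [mul_left_comm (f _)]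
    rw [intervalIntegral.integral_const_mul, integral_mul_integral_rpow_swap hα.2 hab.le hfint hg',
      ← intervalIntegral.integral_const_mul, intervalIntegral.integral_of_le hab.le,
      intervalIntegral.integral_of_le hab.le, integral_Ioc_eq_integral_Ioo,
      integral_Ioc_eq_integral_Ioo]
    refine setIntegral_congr_fun measurableSet_Ioo fun s hs => ?_
    simp only [hφ s (Ioo_subset_Ico_self hs)]
    ring
  have hparts : (∫ s in a..b, φ s * g' s) =
      φ b * g b - φ a * g a - ∫ s in a..b, -ψ s * g s := by
    refine intervalIntegral.integral_mul_deriv_eq_deriv_mul_of_hasDerivAt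
      (by rwa [uIcc_of_le hab.le]) ?_ ?_ ?_ hψint.neg
      (ContinuousOn.intervalIntegrable_of_Icc hab.le hg')
    · rw [uIcc_of_le hab.le]
      exact fun t ht => (hg t ht).continuousWithinAt
    · rwa [min_eq_left hab.le, max_eq_right hab.le]
    · rw [min_eq_left hab.le, max_eq_right hab.le]
      exact fun t ht => (hg t (Ioo_subset_Icc_self ht)).hasDerivAt (Icc_mem_nhds ht.1 ht.2)
  rw [hcaputo, hparts]
  simp only [neg_mul, intervalIntegral.integral_neg, sub_neg_eq_add]
end
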